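/- arXiv:1902.00207 — 3 statements merged into one kernel-verified Lean document; each statement's English description precedes it below -/
import Mathlib

section
/- Let D̃ be the presented Lie algebra associated to a generalized Cartan matrix A of finite or affine type and positive rationals (ε_i) with ε_i a_{ij} = ε_j a_{ji}. Let D̃_+ (respectively D̃_−, D̃_0) be the Lie subalgebra of D̃ generated by the elements x⁺_{i,m} (respectively by the x⁻_{i,m}, respectively by the h_{i,m} together with c), for i ∈ I and m ∈ ℤ. Then: (1) D̃ is the internal direct sum of vector spaces D̃ = D̃_+ ⊕ D̃_0 ⊕ D̃_−; (2) the unique Lie algebra homomorphism from the free Lie algebra over ℂ on the set I × ℤ to D̃ sending (i, m) to x⁺_{i,m} is injective, and likewise for x⁻_{i,m}; i.e., D̃_+ and D̃_− are freely generated by these elements. -/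
/-! Common setup: the presented Lie algebra `D̃` associated to a generalized Cartan
matrix `A` and positive rationals `(ε_i)`. -/

/-- Generators of the presentation: `h_{i,m}`, `x⁺_{i,m}`, `x⁻_{i,m}` and `c`. -/
inductive DGen (I : Type) : Type
  | h : I → ℤ → DGen I
  | xp : I → ℤ → DGen I
  | xm : I → ℤ → DGen I
  | c : DGen I

/-- The free Lie algebra on the generators. -/
abbrev DFree (I : Type) := FreeLieAlgebra ℂ (DGen I)

namespace DFree

variable {I : Type}

noncomputable def H (i : I) (m : ℤ) : DFree I := FreeLieAlgebra.of ℂ (DGen.h i m)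
noncomputable def Xp (i : I) (m : ℤ) : DFree I := FreeLieAlgebra.of ℂ (DGen.xp i m)
noncomputable def Xm (i : I) (m : ℤ) : DFree I := FreeLieAlgebra.of ℂ (DGen.xm i m)
noncomputable def C (I : Type) : DFree I := FreeLieAlgebra.of ℂ (DGen.c : DGen I)

end DFree

/-- The defining relations of `D̃`:
`[h_{i,m}, c] = 0 = [x^±_{i,m}, c]`;
`[h_{i,m}, h_{j,n}] = (m/ε_j) a_{ij} δ_{m+n,0} c`;
`[h_{i,m}, x^±_{j,n}] = ± a_{ij} x^±_{j,m+n}`;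
`[x⁺_{i,m}, x⁻_{j,n}] = δ_{ij} (h_{j,m+n} + (m/ε_j) δ_{m+n,0} c)`. -/
noncomputable def tildeRels {I : Type} [DecidableEq I] (A : I → I → ℤ) (ε : I → ℚ) :
    Set (DFree I) :=
  (Set.range fun p : I × ℤ => ⁅DFree.H p.1 p.2, DFree.C I⁆) ∪
  (Set.range fun p : I × ℤ => ⁅DFree.Xp p.1 p.2, DFree.C I⁆) ∪
  (Set.range fun p : I × ℤ => ⁅DFree.Xm p.1 p.2, DFree.C I⁆) ∪
  (Set.range fun p : (I × ℤ) × (I × ℤ) =>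
    ⁅DFree.H p.1.1 p.1.2, DFree.H p.2.1 p.2.2⁆ -
      (if p.1.2 + p.2.2 = 0 then
          (p.1.2 : ℂ) / (ε p.2.1 : ℂ) * (A p.1.1 p.2.1 : ℂ)
        else 0) • DFree.C I) ∪
  (Set.range fun p : (I × ℤ) × (I × ℤ) =>
    ⁅DFree.H p.1.1 p.1.2, DFree.Xp p.2.1 p.2.2⁆ -
      (A p.1.1 p.2.1 : ℂ) • DFree.Xp p.2.1 (p.1.2 + p.2.2)) ∪
  (Set.range fun p : (I × ℤ) × (I × ℤ) =>
    ⁅DFree.H p.1.1 p.1.2, DFree.Xm p.2.1 p.2.2⁆ +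
      (A p.1.1 p.2.1 : ℂ) • DFree.Xm p.2.1 (p.1.2 + p.2.2)) ∪
  (Set.range fun p : (I × ℤ) × (I × ℤ) =>
    ⁅DFree.Xp p.1.1 p.1.2, DFree.Xm p.2.1 p.2.2⁆ -
      (if p.1.1 = p.2.1 then
          DFree.H p.2.1 (p.1.2 + p.2.2) +
            (if p.1.2 + p.2.2 = 0 then (p.1.2 : ℂ) / (ε p.2.1 : ℂ) else 0) • DFree.C I
        else 0))

/-- The Lie ideal of the free Lie algebra generated by the relations. -/
noncomputable def tildeIdeal {I : Type} [DecidableEq I] (A : I → I → ℤ) (ε : I → ℚ) :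
    LieIdeal ℂ (DFree I) :=
  LieSubmodule.lieSpan ℂ (DFree I) (tildeRels A ε)

/-- The presented Lie algebra `D̃`. -/
abbrev DTilde {I : Type} [DecidableEq I] (A : I → I → ℤ) (ε : I → ℚ) : Type :=
  DFree I ⧸ tildeIdeal A ε

namespace DTilde

variable {I : Type} [DecidableEq I] (A : I → I → ℤ) (ε : I → ℚ)

noncomputable def h (i : I) (m : ℤ) : DTilde A ε :=
  LieSubmodule.Quotient.mk' (tildeIdeal A ε) (DFree.H i m)

noncomputable def xp (i : I) (m : ℤ) : DTilde A ε :=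
  LieSubmodule.Quotient.mk' (tildeIdeal A ε) (DFree.Xp i m)

noncomputable def xm (i : I) (m : ℤ) : DTilde A ε :=
  LieSubmodule.Quotient.mk' (tildeIdeal A ε) (DFree.Xm i m)

noncomputable def c : DTilde A ε :=
  LieSubmodule.Quotient.mk' (tildeIdeal A ε) (DFree.C I)

end DTilde

/-- `A` is a generalized Cartan matrix. -/
def IsGCM {I : Type} (A : I → I → ℤ) : Prop :=
  (∀ i, A i i = 2) ∧ (∀ i j, i ≠ j → A i j ≤ 0) ∧ (∀ i j, A i j = 0 ↔ A j i = 0)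

/-- Indecomposability of `A`. -/
def IsIndecomposable {I : Type} (A : I → I → ℤ) : Prop :=
  ∀ i j : I, Relation.ReflTransGen (fun p q => A p q ≠ 0) i j

/-- The principal minor of `A` indexed by a finite subset `S` of `I`. -/
noncomputable def principalMinor {I : Type} [DecidableEq I] (A : I → I → ℤ)
    (S : Finset I) : ℚ :=
  Matrix.det (fun p q : S => (A p.1 q.1 : ℚ))

/-- `A` is of finite or affine type: every principal minor of `A` is positive, or `A` is
indecomposable with `det A = 0` and every proper principal minor positive. -/
def IsFinOrAffType {I : Type} [Fintype I] [DecidableEq I] (A : I → I → ℤ) : Prop :=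
  (∀ S : Finset I, 0 < principalMinor A S) ∨
    (IsIndecomposable A ∧ principalMinor A Finset.univ = 0 ∧
      ∀ S : Finset I, S ≠ Finset.univ → 0 < principalMinor A S)

attribute [local instance] LieRing.ofAssociativeRing

section LieGeneral

variable {R L : Type*} [CommRing R] [LieRing L] [LieAlgebra R L]

lemma LieSubalgebra.lie_mem_lieSpan_of_generators {s t : Set L}
    (hst : ∀ a ∈ s, ∀ b ∈ t, ⁅a, b⁆ ∈ lieSpan R L t) {a b : L}
    (ha : a ∈ lieSpan R L s) (hb : b ∈ lieSpan R L t) : ⁅a, b⁆ ∈ lieSpan R L t := by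
  induction ha using lieSpan_induction generalizing b with
  | mem a ha =>
    induction hb using lieSpan_induction with
    | mem b hb => exact hst a ha b hb
    | zero => simp
    | add x y _ _ hx hy => rw [lie_add]; exact add_mem hx hy
    | smul r x _ hx => rw [lie_smul]; exact (lieSpan R L t).smul_mem r hx
    | lie x y hx' hy' hx hy =>
      rw [leibniz_lie]
      exact add_mem ((lieSpan R L t).lie_mem hx hy') ((lieSpan R L t).lie_mem hx' hy)
  | zero => simp
  | add x y _ _ hx hy => rw [add_lie]; exact add_mem (hx hb) (hy hb)
  | smul r x _ hx => rw [smul_lie]; exact (lieSpan R L t).smul_mem r (hx hb)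
  | lie x y _ _ hx hy => rw [lie_lie]; exact sub_mem (hx (hy hb)) (hy (hx hb))

lemma LieSubalgebra.lie_mem_sup_lieSpan_of_generators {s t u : Set L}
    (hst : ∀ a ∈ s, ∀ b ∈ t, ⁅a, b⁆ ∈ lieSpan R L u)
    (hut : ∀ a ∈ u, ∀ b ∈ t, ⁅a, b⁆ ∈ lieSpan R L t) {a b : L}
    (ha : a ∈ s) (hb : b ∈ lieSpan R L t) :
    ⁅a, b⁆ ∈ (lieSpan R L u).toSubmodule ⊔ (lieSpan R L t).toSubmodule := by
  have key : ∀ x ∈ (lieSpan R L u).toSubmodule ⊔ (lieSpan R L t).toSubmodule,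
      ∀ y ∈ lieSpan R L t, ⁅x, y⁆ ∈ lieSpan R L t := by
    intro x hx y hy
    obtain ⟨x₁, hx₁, x₂, hx₂, rfl⟩ := Submodule.mem_sup.1 hx
    rw [add_lie]
    exact add_mem (lie_mem_lieSpan_of_generators hut hx₁ hy) ((lieSpan R L t).lie_mem hx₂ hy)
  induction hb using lieSpan_induction with
  | mem b hb => exact Submodule.mem_sup_left (hst a ha b hb)
  | zero => simp
  | add x y _ _ hx hy => rw [lie_add]; exact add_mem hx hy
  | smul r x _ hx => rw [lie_smul]; exact Submodule.smul_mem _ r hx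
  | lie x y hx' hy' hx hy =>
    rw [leibniz_lie]
    refine add_mem (Submodule.mem_sup_right (key _ hx y hy')) (Submodule.mem_sup_right ?_)
    rw [← lie_skew]
    exact neg_mem (key _ hy x hx')

lemma LieSubalgebra.sup_lieSpan_eq_top {p z n : Set L}
    (hgen : lieSpan R L (p ∪ z ∪ n) = ⊤)
    (hzp : ∀ a ∈ z, ∀ b ∈ p, ⁅a, b⁆ ∈ lieSpan R L p)
    (hzn : ∀ a ∈ z, ∀ b ∈ n, ⁅a, b⁆ ∈ lieSpan R L n)
    (hpn : ∀ a ∈ p, ∀ b ∈ n, ⁅a, b⁆ ∈ lieSpan R L z) :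
    (lieSpan R L p).toSubmodule ⊔ (lieSpan R L z).toSubmodule ⊔ (lieSpan R L n).toSubmodule
      = ⊤ := by
  set T := (lieSpan R L p).toSubmodule ⊔ (lieSpan R L z).toSubmodule ⊔
    (lieSpan R L n).toSubmodule with hT
  have hpT : (lieSpan R L p).toSubmodule ≤ T := le_sup_left.trans le_sup_left
  have hzT : (lieSpan R L z).toSubmodule ≤ T := le_sup_right.trans le_sup_left
  have hnT : (lieSpan R L n).toSubmodule ≤ T := le_sup_right
  have hnp : ∀ a ∈ n, ∀ b ∈ p, ⁅a, b⁆ ∈ lieSpan R L z := fun a ha b hb => by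
    rw [← lie_skew]; exact neg_mem (hpn b hb a ha)
  let N : LieSubalgebra R L :=
    { carrier := {y | ∀ t ∈ T, ⁅y, t⁆ ∈ T}
      add_mem' := fun {a b} ha hb t ht => by rw [add_lie]; exact add_mem (ha t ht) (hb t ht)
      zero_mem' := fun t _ => by simp
      smul_mem' := fun r a ha t ht => by rw [smul_lie]; exact T.smul_mem r (ha t ht)
      lie_mem' := fun {a b} ha hb t ht => by
        rw [lie_lie]; exact sub_mem (ha _ (hb t ht)) (hb _ (ha t ht)) }
  have split : ∀ y, (∀ t ∈ lieSpan R L p, ⁅y, t⁆ ∈ T) → (∀ t ∈ lieSpan R L z, ⁅y, t⁆ ∈ T) →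
      (∀ t ∈ lieSpan R L n, ⁅y, t⁆ ∈ T) → y ∈ N := by
    intro y h1 h2 h3 t ht
    obtain ⟨u, hu, c, hc, rfl⟩ := Submodule.mem_sup.1 ht
    obtain ⟨a, ha, b, hb, rfl⟩ := Submodule.mem_sup.1 hu
    rw [lie_add, lie_add]
    exact add_mem (add_mem (h1 a ha) (h2 b hb)) (h3 c hc)
  have hN : N = ⊤ := by
    refine top_le_iff.1 (hgen ▸ lieSpan_le.2 ?_)
    rintro y ((hy | hy) | hy)
    · refine split y (fun t ht => hpT ((lieSpan R L p).lie_mem (subset_lieSpan hy) ht))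
        (fun t ht => hpT ?_) (fun t ht => ?_)
      · rw [← lie_skew]
        exact neg_mem (lie_mem_lieSpan_of_generators hzp ht (subset_lieSpan hy))
      · exact sup_le hzT hnT (lie_mem_sup_lieSpan_of_generators hpn hzn hy ht)
    · exact split y
        (fun t ht => hpT (lie_mem_lieSpan_of_generators hzp (subset_lieSpan hy) ht))
        (fun t ht => hzT ((lieSpan R L z).lie_mem (subset_lieSpan hy) ht))
        (fun t ht => hnT (lie_mem_lieSpan_of_generators hzn (subset_lieSpan hy) ht))
    · refine split y (fun t ht => ?_) (fun t ht => hnT ?_)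
        (fun t ht => hnT ((lieSpan R L n).lie_mem (subset_lieSpan hy) ht))
      · exact sup_le hzT hpT (lie_mem_sup_lieSpan_of_generators hnp hzp hy ht)
      · rw [← lie_skew]
        exact neg_mem (lie_mem_lieSpan_of_generators hzn ht (subset_lieSpan hy))
  let T' : LieSubalgebra R L :=
    { T with
      lie_mem' := fun {a b} _ hb => (hN ▸ LieSubalgebra.mem_top a : a ∈ N) b hb }
  have hT' : T' = ⊤ := by
    refine top_le_iff.1 (hgen ▸ lieSpan_le.2 ?_)
    rintro y ((hy | hy) | hy)
    · exact hpT (subset_lieSpan hy)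
    · exact hzT (subset_lieSpan hy)
    · exact hnT (subset_lieSpan hy)
  exact congrArg LieSubalgebra.toSubmodule hT'

lemma LieSubalgebra.lieSpan_le_biSup_of_graded {ι : Type*} [AddZeroClass ι] {E : ι → Submodule R L}
    (hE : ∀ m n, ∀ x ∈ E m, ∀ y ∈ E n, ⁅x, y⁆ ∈ E (m + n)) (S : AddSubsemigroup ι) {s : Set L}
    (hs : ∀ x ∈ s, ∃ n ∈ S, x ∈ E n) :
    (lieSpan R L s).toSubmodule ≤ ⨆ n ∈ S, E n := by
  have hle : ∀ n ∈ S, E n ≤ ⨆ n ∈ S, E n := fun n hn => le_biSup E hn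
  let K : LieSubalgebra R L :=
    { (⨆ n ∈ S, E n : Submodule R L) with
      lie_mem' := by
        intro a b ha hb
        change a ∈ (⨆ n ∈ S, E n : Submodule R L) at ha
        change b ∈ (⨆ n ∈ S, E n : Submodule R L) at hb
        change ⁅a, b⁆ ∈ (⨆ n ∈ S, E n : Submodule R L)
        rw [iSup_subtype'] at ha hb
        refine Submodule.iSup_induction _ (motive := fun a => ⁅a, b⁆ ∈ _) ha (fun m x hx => ?_)
          (by simp) fun x x' hx hx' => by rw [add_lie]; exact add_mem hx hx'
        refine Submodule.iSup_induction _ (motive := fun b => ⁅x, b⁆ ∈ _) hb (fun n y hy => ?_)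
          (by simp) fun y y' hy hy' => by rw [lie_add]; exact add_mem hy hy'
        exact hle _ (S.add_mem m.2 n.2) (hE _ _ x hx y hy) }
  have : lieSpan R L s ≤ K := lieSpan_le.2 fun x hx => by
    obtain ⟨n, hn, hxn⟩ := hs x hx
    exact hle n hn hxn
  exact this

namespace FreeLieAlgebra

variable {X : Type*}

lemma lieSpan_range_of : LieSubalgebra.lieSpan R (FreeLieAlgebra R X) (Set.range (of R)) = ⊤ := by
  set K := LieSubalgebra.lieSpan R (FreeLieAlgebra R X) (Set.range (of R))
  let f : FreeLieAlgebra R X →ₗ⁅R⁆ K :=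
    lift R fun x => ⟨of R x, LieSubalgebra.subset_lieSpan ⟨x, rfl⟩⟩
  have hf : K.incl.comp f = LieHom.id := by
    ext x
    simp [f]
  refine top_le_iff.1 fun x _ => ?_
  have := LieHom.congr_fun hf x
  exact (show ((f x : K) : FreeLieAlgebra R X) = x from this) ▸ (f x).2

lemma range_lift (f : X → L) :
    (lift R f).range = LieSubalgebra.lieSpan R L (Set.range f) := by
  rw [LieHom.range_eq_map, ← lieSpan_range_of, LieSubalgebra.map_lieSpan, ← Set.range_comp,
    of_comp_lift]

/-- The endomorphism `(l, t) ↦ (⁅x, l⁆ + t x, 0)`; it turns right-normed brackets of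
generators into a representation. -/
noncomputable def bracketOp (x : L) : Module.End R (L × R) :=
  LinearMap.inl R L R ∘ₗ
    LinearMap.coprod (LieAlgebra.ad R L x) (LinearMap.toSpanSingleton R L x)

lemma bracketOp_apply (x : L) (v : L × R) :
    bracketOp (R := R) x v = (⁅x, v.1⁆ + v.2 • x, 0) := by
  simp [bracketOp]

lemma lift_bracketOp_spec (P : FreeLieAlgebra R X) :
    ∃ d : FreeLieAlgebra R X, ∀ v,
      lift R (fun x => bracketOp (R := R) (of R x)) P v = (⁅P, v.1⁆ + v.2 • d, 0) := by
  have hP : P ∈ LieSubalgebra.lieSpan R (FreeLieAlgebra R X) (Set.range (of R)) := by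
    rw [lieSpan_range_of]; trivial
  induction hP using LieSubalgebra.lieSpan_induction with
  | mem x hx =>
    obtain ⟨x, rfl⟩ := hx
    exact ⟨of R x, fun v => by simp [bracketOp_apply]⟩
  | zero => exact ⟨0, fun v => by simp [Prod.ext_iff]⟩
  | add x y _ _ hx hy =>
    obtain ⟨d, hd⟩ := hx
    obtain ⟨e, he⟩ := hy
    refine ⟨d + e, fun v => ?_⟩
    rw [map_add, LinearMap.add_apply, hd, he]
    ext
    · simp only [Prod.mk_add_mk, add_lie, smul_add]; abel
    · simp
  | smul r x _ hx =>
    obtain ⟨d, hd⟩ := hx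
    refine ⟨r • d, fun v => ?_⟩
    rw [map_smul, LinearMap.smul_apply, hd]
    ext
    · simp [smul_comm r v.2]
    · simp
  | lie x y _ _ hx hy =>
    obtain ⟨d, hd⟩ := hx
    obtain ⟨e, he⟩ := hy
    refine ⟨⁅x, e⁆ - ⁅y, d⁆, fun v => ?_⟩
    rw [LieHom.map_lie, LieRing.of_associative_ring_bracket, LinearMap.sub_apply,
      Module.End.mul_apply, Module.End.mul_apply, hd, he, hd, he]
    ext
    · simp only [Prod.mk_sub_mk, lie_add, lie_smul, smul_sub, lie_lie, zero_smul, add_zero]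
      abel
    · simp

variable (R X) in
/-- The degree operator: the value at `(0, 1)` of the right-normed bracket representation. -/
noncomputable def degreeOp : Module.End R (FreeLieAlgebra R X) :=
  LinearMap.fst R (FreeLieAlgebra R X) R ∘ₗ
    LinearMap.applyₗ ((0, 1) : FreeLieAlgebra R X × R) ∘ₗ
    (lift R (fun x => bracketOp (R := R) (of R x))).toLinearMap

lemma lift_bracketOp_apply (P : FreeLieAlgebra R X) (v : FreeLieAlgebra R X × R) :
    lift R (fun x => bracketOp (R := R) (of R x)) P v = (⁅P, v.1⁆ + v.2 • degreeOp R X P, 0) := by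
  obtain ⟨d, hd⟩ := lift_bracketOp_spec P
  have : degreeOp R X P = d := by simp [degreeOp, hd]
  rw [this, hd]

lemma degreeOp_of (x : X) : degreeOp R X (of R x) = of R x := by
  simp [degreeOp, bracketOp_apply]

lemma degreeOp_lie (P Q : FreeLieAlgebra R X) :
    degreeOp R X ⁅P, Q⁆ = ⁅P, degreeOp R X Q⁆ + ⁅degreeOp R X P, Q⁆ := by
  have h := lift_bracketOp_apply ⁅P, Q⁆ (0, 1)
  rw [LieHom.map_lie, LieRing.of_associative_ring_bracket, LinearMap.sub_apply,
      Module.End.mul_apply, Module.End.mul_apply] at h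
  simp only [lift_bracketOp_apply] at h
  have h' := congrArg Prod.fst h
  simp only [lie_zero, one_smul, zero_add, zero_smul, add_zero, Prod.mk_sub_mk] at h'
  rw [← h', ← lie_skew Q, sub_neg_eq_add]

lemma degreeOp_injective (K X : Type*) [Field K] [CharZero K] :
    Function.Injective (degreeOp K X) := by
  rw [injective_iff_map_eq_zero]
  intro P hP
  let E : ℕ → Submodule K (FreeLieAlgebra K X) := fun n => (degreeOp K X).eigenspace (n : K)
  have hE : iSupIndep E := (degreeOp K X).eigenspaces_iSupIndep.comp Nat.cast_injective
  let S : AddSubsemigroup ℕ := ⟨{n | 0 < n}, fun {a b} ha _ => Nat.add_pos_left ha b⟩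
  have htop := LieSubalgebra.lieSpan_le_biSup_of_graded (E := E) (R := K)
    (fun m n x hx y hy => by
      simp only [E, Module.End.mem_eigenspace_iff] at hx hy ⊢
      rw [degreeOp_lie, hx, hy, lie_smul, smul_lie, ← add_smul]
      push_cast
      rw [add_comm]) S (s := Set.range (of K))
    (by
      rintro _ ⟨x, rfl⟩
      exact ⟨1, Nat.one_pos, by simp [E, degreeOp_of]⟩)
  rw [lieSpan_range_of] at htop
  have h0 : P ∈ E 0 := by simp [E, hP]
  have hdisj : Disjoint (E 0) (⨆ n ∈ S, E n) :=
    hE.disjoint_biSup (y := (S : Set ℕ)) (fun h => lt_irrefl 0 h)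
  exact Submodule.disjoint_def.1 hdisj P h0 (htop trivial)

end FreeLieAlgebra

end LieGeneral

section WordModule

variable {K X : Type*} [Field K]

/-- Left multiplication by a letter on the span of words. -/
noncomputable def wordCons (K : Type*) [Field K] {X : Type*} (x : X) :
    Module.End K (List X →₀ K) :=
  Finsupp.lmapDomain K K (List.cons x)

lemma wordCons_single (x : X) (w : List X) (a : K) :
    wordCons K x (Finsupp.single w a) = Finsupp.single (x :: w) a := by
  simp [wordCons]

lemma word_induction {p : (List X →₀ K) → Prop} (zero : p 0)
    (map_add : ∀ v v', p v → p v' → p (v + v')) (map_smul : ∀ (r : K) v, p v → p (r • v))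
    (nil : p (Finsupp.single [] 1)) (cons : ∀ x v, p v → p (wordCons K x v)) (v) : p v := by
  induction v using Finsupp.induction_linear with
  | zero => exact zero
  | add v v' hv hv' => exact map_add v v' hv hv'
  | single w a =>
    have : p (Finsupp.single w 1) := by
      induction w with
      | nil => exact nil
      | cons x w ih => exact wordCons_single (K := K) x w 1 ▸ cons x _ ih
    simpa using map_smul a _ this

/-- A free Lie algebra in characteristic zero acts faithfully on words by left multiplication. -/
lemma FreeLieAlgebra.lift_wordCons_injective (K X : Type*) [Field K] [CharZero K] :
    Function.Injective (FreeLieAlgebra.lift K (wordCons K : X → Module.End K (List X →₀ K))) := by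
  rw [injective_iff_map_eq_zero]
  intro P hP
  let e : (List X →₀ K) →ₗ[K] FreeLieAlgebra K X × K :=
    Finsupp.linearCombination K
      (List.foldr (fun x v => bracketOp (R := K) (of K x) v) ((0, 1) : FreeLieAlgebra K X × K))
  have he : ∀ v, e (FreeLieAlgebra.lift K (wordCons K) P v) =
      lift K (fun x => bracketOp (R := K) (of K x)) P (e v) := by
    clear hP
    have hP : P ∈ LieSubalgebra.lieSpan K (FreeLieAlgebra K X) (Set.range (of K)) := by
      rw [lieSpan_range_of]; trivial
    induction hP using LieSubalgebra.lieSpan_induction with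
    | mem x hx =>
      obtain ⟨x, rfl⟩ := hx
      intro v
      rw [lift_of_apply, lift_of_apply]
      induction v using Finsupp.induction_linear with
      | zero => simp
      | add v v' hv hv' => simp only [map_add, hv, hv']
      | single w a => simp [wordCons_single, e]
    | zero => simp
    | add x y _ _ hx hy => intro v; simp [hx, hy]
    | smul r x _ hx => intro v; simp [hx]
    | lie x y _ _ hx hy =>
      intro v
      simp only [LieHom.map_lie, LieRing.of_associative_ring_bracket, LinearMap.sub_apply,
        Module.End.mul_apply, map_sub, hx, hy]
  have h1 := he (Finsupp.single [] 1)
  rw [hP, lift_bracketOp_apply] at h1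
  have h2 := congrArg Prod.fst h1
  apply degreeOp_injective K X
  simpa [e] using h2.symm

variable {I : Type*} (A : I → I → ℤ)

/-- The action of `h_{i,m}` on words, as a derivation. -/
noncomputable def wordH (i : I) (m : ℤ) : Module.End K (List (I × ℤ) →₀ K) :=
  Finsupp.linearCombination K
    (List.rec 0 fun x w v => wordCons K x v -
      (A i x.1 : K) • Finsupp.single ((x.1, m + x.2) :: w) 1)

lemma wordH_nil (i : I) (m : ℤ) (a : K) : wordH A i m (Finsupp.single [] a) = 0 := by
  simp [wordH]

lemma wordH_cons (i : I) (m : ℤ) (x : I × ℤ) (v : List (I × ℤ) →₀ K) :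
    wordH A i m (wordCons K x v) =
      wordCons K x (wordH A i m v) - (A i x.1 : K) • wordCons K (x.1, m + x.2) v := by
  induction v using Finsupp.induction_linear with
  | zero => simp
  | add v v' hv hv' => simp only [map_add, hv, hv', smul_add]; abel
  | single w a => simp [wordCons_single, wordH, smul_sub, mul_comm]

lemma wordH_comm (i j : I) (m n : ℤ) (v : List (I × ℤ) →₀ K) :
    wordH A i m (wordH A j n v) = wordH A j n (wordH A i m v) := by
  induction v using word_induction with
  | zero => simp
  | map_add v v' hv hv' => simp only [map_add, hv, hv']
  | map_smul r v hv => simp only [map_smul, hv]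
  | nil => simp [wordH_nil]
  | cons x v hv =>
    simp only [wordH_cons, map_sub, map_smul, hv, smul_sub, add_left_comm m n,
      smul_comm (A i x.1 : K)]
    abel

variable [DecidableEq I]

/-- The action of `x⁺_{i,m}` on words. -/
noncomputable def wordX (i : I) (m : ℤ) : Module.End K (List (I × ℤ) →₀ K) :=
  Finsupp.linearCombination K
    (List.rec 0 fun x w v => wordCons K x v +
      if i = x.1 then wordH A i (m + x.2) (Finsupp.single w 1) else 0)

lemma wordX_nil (i : I) (m : ℤ) (a : K) : wordX A i m (Finsupp.single [] a) = 0 := by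
  simp [wordX]

lemma wordX_cons (i : I) (m : ℤ) (x : I × ℤ) (v : List (I × ℤ) →₀ K) :
    wordX A i m (wordCons K x v) =
      wordCons K x (wordX A i m v) + if i = x.1 then wordH A i (m + x.2) v else 0 := by
  induction v using Finsupp.induction_linear with
  | zero => simp
  | add v v' hv hv' =>
    simp only [map_add, hv, hv']
    split_ifs <;> abel
  | single w a =>
    rw [← mul_one a, ← smul_eq_mul, ← Finsupp.smul_single]
    simp only [map_smul, wordCons_single]
    split_ifs <;> simp [wordX, *]

lemma wordH_wordX (i j : I) (m n : ℤ) (v : List (I × ℤ) →₀ K) :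
    wordH A i m (wordX A j n v) =
      wordX A j n (wordH A i m v) + (A i j : K) • wordX A j (m + n) v := by
  induction v using word_induction with
  | zero => simp
  | map_add v v' hv hv' => simp only [map_add, hv, hv', smul_add]; abel
  | map_smul r v hv => simp only [map_smul, hv, smul_add, smul_comm r]
  | nil => simp [wordH_nil, wordX_nil]
  | cons x v hv =>
    simp only [wordH_cons, wordX_cons, map_sub, map_add, map_smul, hv, smul_add]
    by_cases h : j = x.1
    · simp only [h, if_true, wordH_comm A i x.1 m (n + x.2), add_left_comm n m, add_assoc]
      abel
    · simp only [h, if_false, map_zero, smul_zero]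
      abel

end WordModule

namespace DTilde

variable {I : Type} [DecidableEq I] (A : I → I → ℤ) (ε : I → ℚ)

/-- The projection from the free Lie algebra. -/
noncomputable def proj : DFree I →ₗ⁅ℂ⁆ DTilde A ε :=
  { (LieSubmodule.Quotient.mk' (tildeIdeal A ε) : DFree I →ₗ[ℂ] DTilde A ε) with
    map_lie' := rfl }

variable {A ε}

lemma proj_eq_zero {x : DFree I} (hx : x ∈ tildeRels A ε) : proj A ε x = 0 :=
  (LieSubmodule.Quotient.mk_eq_zero (N := tildeIdeal A ε)).2 (LieSubmodule.subset_lieSpan hx)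

variable (A ε)

lemma h_lie_c (i : I) (m : ℤ) : ⁅h A ε i m, c A ε⁆ = 0 :=
  proj_eq_zero (A := A) (ε := ε) (x := ⁅DFree.H i m, DFree.C I⁆) (by simp [tildeRels])

lemma h_lie_h (i j : I) (m n : ℤ) : ⁅h A ε i m, h A ε j n⁆ =
    (if m + n = 0 then (m : ℂ) / (ε j : ℂ) * (A i j : ℂ) else 0) • c A ε :=
  sub_eq_zero.1 <| proj_eq_zero (A := A) (ε := ε) (x := ⁅DFree.H i m, DFree.H j n⁆ -
    (if m + n = 0 then (m : ℂ) / (ε j : ℂ) * (A i j : ℂ) else 0) • DFree.C I) <|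
    .inl <| .inl <| .inl <| .inr ⟨((i, m), (j, n)), rfl⟩

lemma xp_lie_c (i : I) (m : ℤ) : ⁅xp A ε i m, c A ε⁆ = 0 :=
  proj_eq_zero (A := A) (ε := ε) (x := ⁅DFree.Xp i m, DFree.C I⁆) (by simp [tildeRels])

lemma xm_lie_c (i : I) (m : ℤ) : ⁅xm A ε i m, c A ε⁆ = 0 :=
  proj_eq_zero (A := A) (ε := ε) (x := ⁅DFree.Xm i m, DFree.C I⁆) (by simp [tildeRels])

lemma h_lie_xp (i j : I) (m n : ℤ) :
    ⁅h A ε i m, xp A ε j n⁆ = (A i j : ℂ) • xp A ε j (m + n) :=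
  sub_eq_zero.1 <| proj_eq_zero (A := A) (ε := ε)
    (x := ⁅DFree.H i m, DFree.Xp j n⁆ - (A i j : ℂ) • DFree.Xp j (m + n)) <|
    .inl <| .inl <| .inr ⟨((i, m), (j, n)), rfl⟩

lemma h_lie_xm (i j : I) (m n : ℤ) :
    ⁅h A ε i m, xm A ε j n⁆ = -((A i j : ℂ) • xm A ε j (m + n)) :=
  eq_neg_of_add_eq_zero_left <| proj_eq_zero (A := A) (ε := ε)
    (x := ⁅DFree.H i m, DFree.Xm j n⁆ + (A i j : ℂ) • DFree.Xm j (m + n)) <|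
    .inl <| .inr ⟨((i, m), (j, n)), rfl⟩

lemma xp_lie_xm (i j : I) (m n : ℤ) : ⁅xp A ε i m, xm A ε j n⁆ =
    if i = j then h A ε j (m + n) + (if m + n = 0 then (m : ℂ) / (ε j : ℂ) else 0) • c A ε
    else 0 := by
  have := proj_eq_zero (A := A) (ε := ε) (.inr ⟨((i, m), (j, n)), rfl⟩)
  rw [map_sub, sub_eq_zero, apply_ite (proj A ε), map_add, map_smul, map_zero] at this
  exact this

lemma lieSpan_generators : LieSubalgebra.lieSpan ℂ (DTilde A ε)
    ((Set.range fun p : I × ℤ => xp A ε p.1 p.2) ∪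
      ((Set.range fun p : I × ℤ => h A ε p.1 p.2) ∪ {c A ε}) ∪
      Set.range fun p : I × ℤ => xm A ε p.1 p.2) = ⊤ := by
  have hproj : (proj A ε).range = ⊤ :=
    (proj A ε).range_eq_top.2 (LieSubmodule.Quotient.surjective_mk' _)
  rw [LieHom.range_eq_map, ← FreeLieAlgebra.lieSpan_range_of, LieSubalgebra.map_lieSpan] at hproj
  refine top_le_iff.1 (hproj ▸ LieSubalgebra.lieSpan_mono ?_)
  rintro _ ⟨_, ⟨g, rfl⟩, rfl⟩
  cases g with
  | h i m => exact .inl (.inr (.inl ⟨(i, m), rfl⟩))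
  | xp i m => exact .inl (.inl ⟨(i, m), rfl⟩)
  | xm i m => exact .inr ⟨(i, m), rfl⟩
  | c => exact .inl (.inr (.inr rfl))

section Lift

variable {L : Type*} [LieRing L] [LieAlgebra ℂ L]

variable {A ε} in
/-- The homomorphism out of `D̃` determined by a choice of images of the generators. -/
noncomputable def lift (f : DGen I → L)
    (hf : ∀ x ∈ tildeRels A ε, FreeLieAlgebra.lift ℂ f x = 0) : DTilde A ε →ₗ⁅ℂ⁆ L :=
  have hle : tildeIdeal A ε ≤ (FreeLieAlgebra.lift ℂ f).ker :=
    LieSubmodule.lieSpan_le.2 fun x hx => (LieHom.mem_ker).2 (hf x hx)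
  { (tildeIdeal A ε).toSubmodule.liftQ (FreeLieAlgebra.lift ℂ f : DFree I →ₗ[ℂ] L)
      (fun _ hx => hle hx) with
    map_lie' := by
      rintro ⟨x⟩ ⟨y⟩
      exact (FreeLieAlgebra.lift ℂ f).map_lie x y }

lemma lift_eq_zero_of_relations (f : DGen I → L)
    (hhc : ∀ i m, ⁅f (.h i m), f .c⁆ = 0)
    (hpc : ∀ i m, ⁅f (.xp i m), f .c⁆ = 0)
    (hmc : ∀ i m, ⁅f (.xm i m), f .c⁆ = 0)
    (hhh : ∀ i j m n, ⁅f (.h i m), f (.h j n)⁆ =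
      (if m + n = 0 then (m : ℂ) / (ε j : ℂ) * (A i j : ℂ) else 0) • f .c)
    (hhp : ∀ i j m n, ⁅f (.h i m), f (.xp j n)⁆ = (A i j : ℂ) • f (.xp j (m + n)))
    (hhm : ∀ i j m n, ⁅f (.h i m), f (.xm j n)⁆ = -((A i j : ℂ) • f (.xm j (m + n))))
    (hpm : ∀ i j m n, ⁅f (.xp i m), f (.xm j n)⁆ =
      if i = j then f (.h j (m + n)) + (if m + n = 0 then (m : ℂ) / (ε j : ℂ) else 0) • f .c
      else 0) :
    ∀ x ∈ tildeRels A ε, FreeLieAlgebra.lift ℂ f x = 0 := by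
  rintro _ ((((((⟨p, rfl⟩ | ⟨p, rfl⟩) | ⟨p, rfl⟩) | ⟨p, rfl⟩) | ⟨p, rfl⟩) | ⟨p, rfl⟩) | ⟨p, rfl⟩)
  · simp [DFree.H, DFree.C, hhc]
  · simp [DFree.Xp, DFree.C, hpc]
  · simp [DFree.Xm, DFree.C, hmc]
  · simp only [map_sub, map_smul, LieHom.map_lie, DFree.H, DFree.C, FreeLieAlgebra.lift_of_apply,
      hhh, sub_self]
  · simp [DFree.H, DFree.Xp, hhp]
  · simp [DFree.H, DFree.Xm, hhm]
  · simp [DFree.H, DFree.Xp, DFree.Xm, DFree.C, hpm, apply_ite (FreeLieAlgebra.lift ℂ f)]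

end Lift

/-- The involution exchanging `x⁺` and `x⁻`. -/
noncomputable def flip : DTilde A ε →ₗ⁅ℂ⁆ DTilde A ε :=
  lift (fun
    | .h i m => -h A ε i (-m)
    | .xp i m => -xm A ε i (-m)
    | .xm i m => -xp A ε i (-m)
    | .c => -c A ε) <| by
  apply lift_eq_zero_of_relations
  · intro i m; simp [h_lie_c]
  · intro i m; simp [xm_lie_c]
  · intro i m; simp [xp_lie_c]
  · intro i j m n
    have hmn : -m + -n = 0 ↔ m + n = 0 := by omega
    simp only [neg_lie, lie_neg, h_lie_h, hmn]
    split_ifs <;> simp [neg_div]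
  · intro i j m n
    simp [h_lie_xm, neg_add_rev, add_comm]
  · intro i j m n
    simp [h_lie_xp, neg_add_rev, add_comm]
  · intro i j m n
    have hmn : -n + -m = 0 ↔ m + n = 0 := by omega
    have hmn' : -n + -m = -(m + n) := by omega
    simp only [neg_lie, lie_neg, neg_neg]
    rw [← lie_skew, xp_lie_xm]
    by_cases hij : i = j
    · subst hij
      simp only [if_true, if_congr hmn rfl rfl]
      rw [hmn']
      by_cases h0 : m + n = 0
      · obtain rfl : n = -m := by omega
        simp [add_comm]
      · simp [h0]
    · simp [hij, Ne.symm hij]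

/-- The endomorphism scaling `x⁺` by `2` and `x⁻` by `1 / 2`. -/
noncomputable def scale : DTilde A ε →ₗ⁅ℂ⁆ DTilde A ε :=
  lift (fun
    | .h i m => h A ε i m
    | .xp i m => (2 : ℂ) • xp A ε i m
    | .xm i m => (2 : ℂ)⁻¹ • xm A ε i m
    | .c => c A ε) <| by
  apply lift_eq_zero_of_relations
  · intro i m; simp [h_lie_c]
  · intro i m; simp [xp_lie_c]
  · intro i m; simp [xm_lie_c]
  · intro i j m n; exact h_lie_h A ε i j m n
  · intro i j m n; simp [h_lie_xp, smul_comm (2 : ℂ)]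
  · intro i j m n; simp [h_lie_xm, smul_comm (2 : ℂ)⁻¹]
  · intro i j m n; simp [xp_lie_xm]

/-- The representation of `D̃` on words, with `x⁻` acting by left multiplication. -/
noncomputable def wordRep : DTilde A ε →ₗ⁅ℂ⁆ Module.End ℂ (List (I × ℤ) →₀ ℂ) :=
  lift (fun
    | .h i m => wordH A i m
    | .xp i m => wordX A i m
    | .xm i m => wordCons ℂ (i, m)
    | .c => 0) <| by
  apply lift_eq_zero_of_relations
  · intro i m; simp [LieRing.of_associative_ring_bracket]
  · intro i m; simp [LieRing.of_associative_ring_bracket]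
  · intro i m; simp [LieRing.of_associative_ring_bracket]
  · intro i j m n
    refine LinearMap.ext fun v => ?_
    simp [LieRing.of_associative_ring_bracket, wordH_comm A i j m n v]
  · intro i j m n
    refine LinearMap.ext fun v => ?_
    simp [LieRing.of_associative_ring_bracket, wordH_wordX]
  · intro i j m n
    refine LinearMap.ext fun v => ?_
    simp [LieRing.of_associative_ring_bracket, wordH_cons]
  · intro i j m n
    refine LinearMap.ext fun v => ?_
    by_cases hij : i = j
    · subst hij
      simp [LieRing.of_associative_ring_bracket, wordX_cons]
    · simp [LieRing.of_associative_ring_bracket, wordX_cons, hij]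

lemma flip_xp (i : I) (m : ℤ) : flip A ε (xp A ε i m) = -xm A ε i (-m) :=
  FreeLieAlgebra.lift_of_apply _ _

lemma scale_h (i : I) (m : ℤ) : scale A ε (h A ε i m) = h A ε i m :=
  FreeLieAlgebra.lift_of_apply _ _

lemma scale_c : scale A ε (c A ε) = c A ε :=
  FreeLieAlgebra.lift_of_apply _ _

lemma scale_xp (i : I) (m : ℤ) : scale A ε (xp A ε i m) = (2 : ℂ) • xp A ε i m :=
  FreeLieAlgebra.lift_of_apply _ _

lemma scale_xm (i : I) (m : ℤ) : scale A ε (xm A ε i m) = (2 : ℂ)⁻¹ • xm A ε i m :=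
  FreeLieAlgebra.lift_of_apply _ _

lemma wordRep_xm (i : I) (m : ℤ) : wordRep A ε (xm A ε i m) = wordCons ℂ (i, m) :=
  FreeLieAlgebra.lift_of_apply _ _

lemma lift_xm_injective :
    Function.Injective (FreeLieAlgebra.lift ℂ (fun p : I × ℤ => xm A ε p.1 p.2)) := by
  have hcomp : (wordRep A ε).comp (FreeLieAlgebra.lift ℂ (fun p : I × ℤ => xm A ε p.1 p.2)) =
      FreeLieAlgebra.lift ℂ (wordCons ℂ) := by
    ext x : 1
    simp [wordRep_xm]
  have := FreeLieAlgebra.lift_wordCons_injective ℂ (I × ℤ)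
  rw [← hcomp, LieHom.coe_comp] at this
  exact this.of_comp

lemma lift_xp_injective :
    Function.Injective (FreeLieAlgebra.lift ℂ (fun p : I × ℤ => xp A ε p.1 p.2)) := by
  let τ : FreeLieAlgebra ℂ (I × ℤ) →ₗ⁅ℂ⁆ FreeLieAlgebra ℂ (I × ℤ) :=
    FreeLieAlgebra.lift ℂ fun p => -FreeLieAlgebra.of ℂ (p.1, -p.2)
  have hτ : τ.comp τ = LieHom.id := by
    ext x
    simp [τ]
  have hcomp : (flip A ε).comp (FreeLieAlgebra.lift ℂ (fun p : I × ℤ => xp A ε p.1 p.2)) =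
      (FreeLieAlgebra.lift ℂ (fun p : I × ℤ => xm A ε p.1 p.2)).comp τ := by
    ext x
    simp [flip_xp, τ]
  have hτ' : Function.Injective τ :=
    Function.LeftInverse.injective (g := τ) fun x => LieHom.congr_fun hτ x
  have := (lift_xm_injective A ε).comp hτ'
  rw [← LieHom.coe_comp, ← hcomp, LieHom.coe_comp] at this
  exact this.of_comp

/-- The grading of `D̃` by the number of `x⁺` minus the number of `x⁻`. -/
noncomputable def degreePart (n : ℤ) : Submodule ℂ (DTilde A ε) :=
  Module.End.eigenspace (scale A ε).toLinearMap ((2 : ℂ) ^ n)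

lemma mem_degreePart {n : ℤ} {x : DTilde A ε} :
    x ∈ degreePart A ε n ↔ scale A ε x = (2 : ℂ) ^ n • x :=
  Module.End.mem_eigenspace_iff

lemma iSupIndep_degreePart : iSupIndep (degreePart A ε) := by
  refine (Module.End.eigenspaces_iSupIndep _).comp fun m n hmn => ?_
  have h2 : ((2 : ℝ) : ℂ) ^ m = ((2 : ℝ) : ℂ) ^ n := by simpa using hmn
  exact zpow_right_injective₀ (a := (2 : ℝ)) (by norm_num) (by norm_num) (show (2 : ℝ) ^ m = 2 ^ n from mod_cast h2)

lemma lie_mem_degreePart (m n : ℤ) : ∀ x ∈ degreePart A ε m, ∀ y ∈ degreePart A ε n,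
    ⁅x, y⁆ ∈ degreePart A ε (m + n) := by
  intro x hx y hy
  rw [mem_degreePart] at hx hy ⊢
  rw [LieHom.map_lie, hx, hy, lie_smul, smul_lie, smul_smul, zpow_add₀ two_ne_zero, mul_comm]

/-- The three generating sets of the triangular decomposition. -/
noncomputable def triangularGenerators : Fin 3 → Set (DTilde A ε) :=
  ![Set.range fun p : I × ℤ => xp A ε p.1 p.2,
    (Set.range fun p : I × ℤ => h A ε p.1 p.2) ∪ {c A ε},
    Set.range fun p : I × ℤ => xm A ε p.1 p.2]

lemma exists_lieSpan_triangularGenerators_le : ∃ S : Fin 3 → Set ℤ,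
    Pairwise (Function.onFun Disjoint S) ∧ ∀ k,
      (LieSubalgebra.lieSpan ℂ (DTilde A ε) (triangularGenerators A ε k)).toSubmodule ≤
        ⨆ n ∈ S k, degreePart A ε n := by
  let S : Fin 3 → AddSubsemigroup ℤ :=
    ![⟨{n | 0 < n}, fun {a b} ha hb => add_pos (show 0 < a from ha) hb⟩,
      ⟨{0}, by simp⟩,
      ⟨{n | n < 0}, fun {a b} ha hb => add_neg (show a < 0 from ha) hb⟩]
  refine ⟨fun k => S k, ?_, fun k => LieSubalgebra.lieSpan_le_biSup_of_graded
    (lie_mem_degreePart A ε) (S k) ?_⟩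
  · have h01 : Disjoint {n : ℤ | 0 < n} {0} := by simp
    have h02 : Disjoint {n : ℤ | 0 < n} {n : ℤ | n < 0} :=
      Set.disjoint_left.2 fun n (h : 0 < n) (h' : n < 0) => lt_asymm h h'
    have h12 : Disjoint {0} {n : ℤ | n < 0} := by simp
    intro j k hjk
    fin_cases j <;> fin_cases k
    exacts [absurd rfl hjk, h01, h02, h01.symm, absurd rfl hjk, h12, h02.symm, h12.symm,
      absurd rfl hjk]
  · fin_cases k
    · rintro _ ⟨p, rfl⟩
      exact ⟨1, Int.one_pos, by simp [mem_degreePart, scale_xp]⟩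
    · rintro _ (⟨p, rfl⟩ | rfl)
      · exact ⟨0, rfl, by simp [mem_degreePart, scale_h]⟩
      · exact ⟨0, rfl, by simp [mem_degreePart, scale_c]⟩
    · rintro _ ⟨p, rfl⟩
      exact ⟨-1, neg_one_lt_zero (R := ℤ), by simp [mem_degreePart, scale_xm]⟩

lemma iSupIndep_triangular : iSupIndep fun k =>
    (LieSubalgebra.lieSpan ℂ (DTilde A ε) (triangularGenerators A ε k)).toSubmodule := by
  obtain ⟨S, hS, hle⟩ := exists_lieSpan_triangularGenerators_le A ε
  intro k
  have hdisj : Disjoint (S k) (⋃ j ≠ k, S j) := by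
    simp only [Set.disjoint_iUnion_right]
    exact fun j hj => hS hj.symm
  refine ((iSupIndep_degreePart A ε).disjoint_biSup_biSup hdisj).mono (hle k) ?_
  refine iSup₂_le fun j hj => (hle j).trans (biSup_mono fun n hn => ?_)
  exact Set.mem_iUnion₂.2 ⟨j, hj, hn⟩

lemma sup_triangular :
    (LieSubalgebra.lieSpan ℂ (DTilde A ε)
        (Set.range fun p : I × ℤ => xp A ε p.1 p.2)).toSubmodule ⊔
      (LieSubalgebra.lieSpan ℂ (DTilde A ε)
        ((Set.range fun p : I × ℤ => h A ε p.1 p.2) ∪ {c A ε})).toSubmodule ⊔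
      (LieSubalgebra.lieSpan ℂ (DTilde A ε)
        (Set.range fun p : I × ℤ => xm A ε p.1 p.2)).toSubmodule = ⊤ := by
  refine LieSubalgebra.sup_lieSpan_eq_top (lieSpan_generators A ε) ?_ ?_ ?_
  · rintro _ (⟨p, rfl⟩ | rfl) _ ⟨q, rfl⟩
    · dsimp only
      rw [h_lie_xp]
      exact LieSubalgebra.smul_mem _ _ (LieSubalgebra.subset_lieSpan ⟨(q.1, p.2 + q.2), rfl⟩)
    · rw [← lie_skew, xp_lie_c, neg_zero]
      exact zero_mem _
  · rintro _ (⟨p, rfl⟩ | rfl) _ ⟨q, rfl⟩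
    · dsimp only
      rw [h_lie_xm]
      exact neg_mem (LieSubalgebra.smul_mem _ _ (LieSubalgebra.subset_lieSpan ⟨(q.1, p.2 + q.2), rfl⟩))
    · rw [← lie_skew, xm_lie_c, neg_zero]
      exact zero_mem _
  · rintro _ ⟨p, rfl⟩ _ ⟨q, rfl⟩
    dsimp only
    rw [xp_lie_xm]
    split_ifs with hpq
    · exact add_mem (LieSubalgebra.subset_lieSpan (.inl ⟨(q.1, p.2 + q.2), rfl⟩))
        (LieSubalgebra.smul_mem _ _ (LieSubalgebra.subset_lieSpan (.inr rfl)))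
    · rw [zero_smul, add_zero]
      exact LieSubalgebra.subset_lieSpan (.inl ⟨(q.1, p.2 + q.2), rfl⟩)
    · exact zero_mem _

end DTilde

/-- triangular decomposition `D̃ = D̃_+ ⊕ D̃_0 ⊕ D̃_−` and freeness of
`D̃_+` and `D̃_−` on the generators `x^±_{i,m}`. -/
theorem stmt9 {I : Type} [Fintype I] [DecidableEq I]
    (A : I → I → ℤ) (hGCM : IsGCM A) (hFA : IsFinOrAffType A)
    (ε : I → ℚ) (hε : ∀ i, 0 < ε i)
    (hsym : ∀ i j, (ε i : ℚ) * (A i j : ℚ) = (ε j : ℚ) * (A j i : ℚ)) :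
    -- (1) triangular decomposition as an internal direct sum of vector spaces
    DirectSum.IsInternal
      ![(LieSubalgebra.lieSpan ℂ (DTilde A ε)
            (Set.range fun p : I × ℤ => DTilde.xp A ε p.1 p.2) : Submodule ℂ (DTilde A ε)),
        (LieSubalgebra.lieSpan ℂ (DTilde A ε)
            ((Set.range fun p : I × ℤ => DTilde.h A ε p.1 p.2) ∪
              {DTilde.c A ε}) : Submodule ℂ (DTilde A ε)),
        (LieSubalgebra.lieSpan ℂ (DTilde A ε)
            (Set.range fun p : I × ℤ => DTilde.xm A ε p.1 p.2) : Submodule ℂ (DTilde A ε))] ∧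
    -- (2) the canonical map from the free Lie algebra on `I × ℤ` sending `(i,m)` to
    -- `x⁺_{i,m}` is injective with image `D̃_+`, and likewise for `x⁻_{i,m}`.
    (Function.Injective
        (FreeLieAlgebra.lift ℂ (fun p : I × ℤ => DTilde.xp A ε p.1 p.2)) ∧
      (FreeLieAlgebra.lift ℂ (fun p : I × ℤ => DTilde.xp A ε p.1 p.2)).range =
        LieSubalgebra.lieSpan ℂ (DTilde A ε)
          (Set.range fun p : I × ℤ => DTilde.xp A ε p.1 p.2)) ∧
    (Function.Injective
        (FreeLieAlgebra.lift ℂ (fun p : I × ℤ => DTilde.xm A ε p.1 p.2)) ∧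
      (FreeLieAlgebra.lift ℂ (fun p : I × ℤ => DTilde.xm A ε p.1 p.2)).range =
        LieSubalgebra.lieSpan ℂ (DTilde A ε)
          (Set.range fun p : I × ℤ => DTilde.xm A ε p.1 p.2)) := by
  refine ⟨?_, ⟨DTilde.lift_xp_injective A ε, FreeLieAlgebra.range_lift _⟩,
    DTilde.lift_xm_injective A ε, FreeLieAlgebra.range_lift _⟩
  rw [DirectSum.isInternal_submodule_iff_iSupIndep_and_iSup_eq_top]
  constructor
  · convert DTilde.iSupIndep_triangular A ε using 1
    ext k : 1
    fin_cases k <;> rfl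
  · rw [← DTilde.sup_triangular A ε]
    refine le_antisymm (iSup_le fun k => ?_) (sup_le (sup_le ?_ ?_) ?_)
    · fin_cases k
      exacts [le_sup_left.trans le_sup_left, le_sup_right.trans le_sup_left, le_sup_right]
    · exact le_iSup_of_le 0 le_rfl
    · exact le_iSup_of_le 1 le_rfl
    · exact le_iSup_of_le 2 le_rfl
end

section
/- Assume A is a generalized Cartan matrix of finite or affine type that is not of type A₁⁽¹⁾ (i.e., A is not the 2×2 matrix with off-diagonal entries −2). Let D̂ be the quotient of the presented Lie algebra D̃ by the Lie ideal generated by the elements [x^±_{i,m+1}, x^±_{j,n}] − [x^±_{i,m}, x^±_{j,n+1}] for all i, j ∈ I with a_{ij} ≠ 0 and all m, n ∈ ℤ, and [x^±_{i,m}, x^±_{j,n}] for all i, j ∈ I with a_{ij} = 0 and all m, n ∈ ℤ, for both signs ±. Then in D̂, for every pair (i, j) ∈ I × I with a_{ij} < 0, setting b = 1 − a_{ij}, for every k ∈ I, all m_1, …, m_b, n, p ∈ ℤ, and each sign ±: [[x^±_{i,m_1}, [x^±_{i,m_2}, [⋯, [x^±_{i,m_b}, x^±_{j,n}] ⋯]]],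 x^∓_{k,p}] = 0. -/
/-- Iterated bracket `⁅u₁, ⁅u₂, ⋯ ⁅u_b, y⁆ ⋯⁆⁆`. -/
def iterBracket {L : Type} [LieRing L] (us : List L) (y : L) : L :=
  us.foldr (fun u acc => ⁅u, acc⁆) y

section Stmt12

variable {I : Type} [Fintype I] [DecidableEq I] (A : I → I → ℤ) (ε : I → ℚ)

/-- The locality relations imposed on `D̃`: for `a_{ij} ≠ 0`,
`[x^±_{i,m+1}, x^±_{j,n}] − [x^±_{i,m}, x^±_{j,n+1}]`, and for `a_{ij} = 0`,
`[x^±_{i,m}, x^±_{j,n}]`. -/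
noncomputable def localityRels : Set (DTilde A ε) :=
  {z | ∃ (i j : I) (m n : ℤ), A i j ≠ 0 ∧
      (z = ⁅DTilde.xp A ε i (m + 1), DTilde.xp A ε j n⁆ -
            ⁅DTilde.xp A ε i m, DTilde.xp A ε j (n + 1)⁆ ∨
        z = ⁅DTilde.xm A ε i (m + 1), DTilde.xm A ε j n⁆ -
            ⁅DTilde.xm A ε i m, DTilde.xm A ε j (n + 1)⁆)} ∪
  {z | ∃ (i j : I) (m n : ℤ), A i j = 0 ∧
      (z = ⁅DTilde.xp A ε i m, DTilde.xp A ε j n⁆ ∨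
        z = ⁅DTilde.xm A ε i m, DTilde.xm A ε j n⁆)}

noncomputable def localityIdeal : LieIdeal ℂ (DTilde A ε) :=
  LieSubmodule.lieSpan ℂ (DTilde A ε) (localityRels A ε)

/-- The quotient `D̂` of `D̃` by the locality relations. -/
abbrev DHat : Type := DTilde A ε ⧸ localityIdeal A ε

noncomputable def DHat.xp (i : I) (m : ℤ) : DHat A ε :=
  LieSubmodule.Quotient.mk' (localityIdeal A ε) (DTilde.xp A ε i m)

noncomputable def DHat.xm (i : I) (m : ℤ) : DHat A ε :=
  LieSubmodule.Quotient.mk' (localityIdeal A ε) (DTilde.xm A ε i m)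

end Stmt12

/-- `serreWord x i j r N` is the iterated bracket
`⁅x_{i,0}, ⋯ ⁅x_{i,0}, x_{j,N}⁆ ⋯⁆` with `r` letters `x_{i,0}`. -/
def serreWord {I L : Type} [LieRing L] (x : I → ℤ → L) (i j : I) : ℕ → ℤ → L
  | 0, N => x j N
  | r + 1, N => ⁅x i 0, serreWord x i j r N⁆

section SerreWord

variable {I L : Type} [LieRing L] {x y : I → ℤ → L} {i j : I}

theorem lie_self_family_eq_zero [LieAlgebra ℂ L]
    (hloc : ∀ m n, ⁅x i (m + 1), x i n⁆ = ⁅x i m, x i (n + 1)⁆) (m n : ℤ) :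
    ⁅x i m, x i n⁆ = 0 := by
  have shift : ∀ k m n : ℤ, ⁅x i (m + k), x i n⁆ = ⁅x i m, x i (n + k)⁆ := by
    intro k
    induction k using Int.induction_on with
    | zero => simp
    | succ k ih => intro m n; rw [← add_assoc, hloc, ih, add_assoc, add_comm 1 (k : ℤ)]
    | pred k ih =>
      intro m n
      have h1 := ih (m - 1) (n - 1)
      have h2 := hloc (m + (-k - 1)) (n - 1)
      have h3 := hloc (m - 1) (n - 1 + -k)
      rw [show m + (-(k : ℤ) - 1) + 1 = m - 1 + -k + 1 by ring,
        show n - 1 + 1 = n by ring] at h2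
      rw [show m - 1 + 1 = m by ring] at h3
      rw [← h2, hloc, show n - 1 + 1 = n by ring]
      have h4 := ih (m - 1) n
      rw [h4, show n + (-(k : ℤ) - 1) = n - 1 + -k by ring, h3]
      congr 2; ring
  have h := shift (n - m) m m
  rw [show m + (n - m) = n by ring, ← lie_skew, neg_eq_iff_add_eq_zero, ← two_smul ℂ] at h
  exact (smul_eq_zero.mp h).resolve_left two_ne_zero

theorem lie_shift_eq (hloc : ∀ m n, ⁅x i (m + 1), x j n⁆ = ⁅x i m, x j (n + 1)⁆) (m n : ℤ) :
    ⁅x i m, x j n⁆ = ⁅x i 0, x j (m + n)⁆ := by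
  induction m using Int.induction_on generalizing n with
  | zero => simp
  | succ k ih => rw [hloc, ih, add_right_comm, add_assoc]
  | pred k ih =>
    have h := hloc (-k - 1) (n - 1)
    rw [sub_add_cancel, sub_add_cancel, ih] at h
    rw [← h]; congr 2; ring

theorem lie_serreWord (hcomm : ∀ m n, ⁅x i m, x i n⁆ = 0)
    (hshift : ∀ m n, ⁅x i m, x j n⁆ = ⁅x i 0, x j (m + n)⁆) (r : ℕ) (m N : ℤ) :
    ⁅x i m, serreWord x i j r N⁆ = serreWord x i j (r + 1) (m + N) := by
  induction r with
  | zero => exact hshift m N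
  | succ r ih =>
    rw [serreWord, leibniz_lie, hcomm, zero_lie, zero_add, ih, ← serreWord]

theorem iterBracket_eq_serreWord (hcomm : ∀ m n, ⁅x i m, x i n⁆ = 0)
    (hshift : ∀ m n, ⁅x i m, x j n⁆ = ⁅x i 0, x j (m + n)⁆) (l : List ℤ) (n : ℤ) :
    iterBracket (l.map (x i)) (x j n) = serreWord x i j l.length (l.sum + n) := by
  induction l with
  | nil => simp [iterBracket, serreWord]
  | cons m l ih =>
    change ⁅x i m, iterBracket (l.map (x i)) (x j n)⁆ = _
    rw [ih, lie_serreWord hcomm hshift, List.length_cons, List.sum_cons, add_assoc]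

theorem serreWord_succ_lie (r : ℕ) (N : ℤ) (z : L) :
    ⁅serreWord x i j (r + 1) N, z⁆ =
      ⁅x i 0, ⁅serreWord x i j r N, z⁆⁆ + ⁅⁅x i 0, z⁆, serreWord x i j r N⁆ := by
  rw [serreWord, lie_lie, ← lie_skew ⁅x i 0, z⁆, sub_eq_add_neg]

theorem serreWord_lie_of_ne {k : I} (hki : k ≠ i) (hkj : k ≠ j)
    (hne : ∀ i k m p, i ≠ k → ⁅x i m, y k p⁆ = 0) (r : ℕ) (N p : ℤ) :
    ⁅serreWord x i j r N, y k p⁆ = 0 := by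
  induction r with
  | zero => exact hne _ _ _ _ hkj.symm
  | succ r ih => rw [serreWord_succ_lie, ih, hne _ _ _ _ hki.symm, lie_zero, zero_lie, add_zero]

variable [LieAlgebra ℂ L] {A : I → I → ℤ}

theorem lie_lie_serreWord (hii : A i i = 2) (hcomm : ∀ m n, ⁅x i m, x i n⁆ = 0)
    (hshift : ∀ m n, ⁅x i m, x j n⁆ = ⁅x i 0, x j (m + n)⁆)
    (hH : ∀ i j m p n, ⁅⁅x i m, y i p⁆, x j n⁆ = (A i j : ℂ) • x j (m + p + n))
    (r : ℕ) (N p : ℤ) :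
    ⁅⁅x i 0, y i p⁆, serreWord x i j r N⁆ =
      (2 * r + A i j : ℂ) • serreWord x i j r (p + N) := by
  induction r with
  | zero => simp [serreWord, hH]
  | succ r ih =>
    rw [serreWord, leibniz_lie, hH, ih, hii, smul_lie, lie_smul, lie_serreWord hcomm hshift,
      zero_add, add_zero, ← serreWord, ← add_smul]
    congr 1
    push_cast; ring

theorem serreWord_succ_lie_left (hii : A i i = 2) (hij : i ≠ j)
    (hcomm : ∀ m n, ⁅x i m, x i n⁆ = 0)
    (hshift : ∀ m n, ⁅x i m, x j n⁆ = ⁅x i 0, x j (m + n)⁆)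
    (hne : ∀ i k m p, i ≠ k → ⁅x i m, y k p⁆ = 0)
    (hH : ∀ i j m p n, ⁅⁅x i m, y i p⁆, x j n⁆ = (A i j : ℂ) • x j (m + p + n))
    (r : ℕ) (N p : ℤ) :
    ⁅serreWord x i j (r + 1) N, y i p⁆ =
      ((r + 1) * (r + A i j) : ℂ) • serreWord x i j r (p + N) := by
  induction r with
  | zero => simp [serreWord, hne _ _ _ _ hij.symm, hH]
  | succ r ih =>
    rw [serreWord_succ_lie, ih, lie_lie_serreWord hii hcomm hshift hH, lie_smul, ← serreWord,
      ← add_smul]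
    congr 1
    push_cast; ring

theorem serreWord_lie_right (hij : i ≠ j) (hcomm : ∀ m n, ⁅x i m, x i n⁆ = 0)
    (hne : ∀ i k m p, i ≠ k → ⁅x i m, y k p⁆ = 0)
    (hH : ∀ i j m p n, ⁅⁅x i m, y i p⁆, x j n⁆ = (A i j : ℂ) • x j (m + p + n))
    (r : ℕ) (N p : ℤ) :
    ⁅serreWord x i j (r + 2) N, y j p⁆ = 0 := by
  induction r with
  | zero =>
    rw [serreWord_succ_lie, serreWord_succ_lie, hne _ _ _ _ hij, zero_lie, zero_lie, add_zero,
      add_zero, serreWord, ← lie_skew (x i 0) ⁅x j N, y j p⁆, hH, lie_neg, lie_smul, hcomm,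
      smul_zero, neg_zero]
  | succ r ih => rw [serreWord_succ_lie, ih, hne _ _ _ _ hij, lie_zero, zero_lie, add_zero]

/-- The Serre element of a family satisfying the locality relations commutes with the opposite
family. -/
theorem serre_lie_eq_zero (hA : IsGCM A)
    (hloc : ∀ i j m n, A i j ≠ 0 → ⁅x i (m + 1), x j n⁆ = ⁅x i m, x j (n + 1)⁆)
    (hne : ∀ i k m p, i ≠ k → ⁅x i m, y k p⁆ = 0)
    (hH : ∀ i j m p n, ⁅⁅x i m, y i p⁆, x j n⁆ = (A i j : ℂ) • x j (m + p + n))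
    (hij : A i j < 0) (k : I) (m : Fin (1 - A i j).toNat → ℤ) (n p : ℤ) :
    ⁅iterBracket (List.ofFn fun t => x i (m t)) (x j n), y k p⁆ = 0 := by
  have hii := hA.1 i
  have hne_ij : i ≠ j := by rintro rfl; omega
  have hcomm : ∀ m n, ⁅x i m, x i n⁆ = 0 :=
    lie_self_family_eq_zero fun m n => hloc i i m n (by omega)
  have hshift : ∀ m n, ⁅x i m, x j n⁆ = ⁅x i 0, x j (m + n)⁆ :=
    lie_shift_eq fun m n => hloc i j m n hij.ne
  have hlist : (List.ofFn fun t => x i (m t)) = (List.ofFn m).map (x i) := by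
    rw [List.map_ofFn]; rfl
  rw [hlist, iterBracket_eq_serreWord hcomm hshift, List.length_ofFn]
  obtain ⟨r, hr⟩ : ∃ r : ℕ, (1 - A i j).toNat = r + 2 := ⟨(-1 - A i j).toNat, by omega⟩
  have hrA : A i j = -((r : ℤ) + 1) := by omega
  generalize (List.ofFn m).sum + n = N
  rw [hr]
  by_cases hki : k = i
  · subst hki
    rw [serreWord_succ_lie_left hii hne_ij hcomm hshift hne hH, hrA]
    push_cast
    rw [add_neg_cancel, mul_zero, zero_smul]
  · by_cases hkj : k = j
    · subst hkj
      exact serreWord_lie_right hne_ij hcomm hne hH r _ p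
    · exact serreWord_lie_of_ne hki hkj hne _ _ _

end SerreWord

namespace DHat

variable {I : Type} [DecidableEq I] (A : I → I → ℤ) (ε : I → ℚ)

/-- The canonical map from the free Lie algebra to `D̂`. -/
noncomputable def proj (z : DFree I) : DHat A ε :=
  LieSubmodule.Quotient.mk' (localityIdeal A ε) (LieSubmodule.Quotient.mk' (tildeIdeal A ε) z)

theorem proj_sub (u v : DFree I) : proj A ε (u - v) = proj A ε u - proj A ε v := rfl

variable {A ε}

theorem proj_eq_zero {z : DFree I} (hz : z ∈ tildeRels A ε) : proj A ε z = 0 := by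
  have h : LieSubmodule.Quotient.mk' (tildeIdeal A ε) z = 0 :=
    (LieSubmodule.Quotient.mk_eq_zero _).2 (LieSubmodule.subset_lieSpan hz)
  rw [proj, h, map_zero]

theorem xp_lie_c (i : I) (m : ℤ) : ⁅xp A ε i m, proj A ε (DFree.C I)⁆ = 0 :=
  proj_eq_zero (.inl (.inl (.inl (.inl (.inl (.inr ⟨(i, m), rfl⟩))))))

theorem xm_lie_c (i : I) (m : ℤ) : ⁅xm A ε i m, proj A ε (DFree.C I)⁆ = 0 :=
  proj_eq_zero (.inl (.inl (.inl (.inl (.inr ⟨(i, m), rfl⟩)))))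

theorem h_lie_xp (i j : I) (m n : ℤ) :
    ⁅proj A ε (DFree.H i m), xp A ε j n⁆ = (A i j : ℂ) • xp A ε j (m + n) :=
  sub_eq_zero.1 (proj_eq_zero (A := A) (ε := ε) (.inl (.inl (.inr ⟨((i, m), (j, n)), rfl⟩))))

theorem h_lie_xm (i j : I) (m n : ℤ) :
    ⁅proj A ε (DFree.H i m), xm A ε j n⁆ = -((A i j : ℂ) • xm A ε j (m + n)) :=
  eq_neg_of_add_eq_zero_left
    (proj_eq_zero (A := A) (ε := ε) (.inl (.inr ⟨((i, m), (j, n)), rfl⟩)))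

theorem xp_lie_xm_of_ne {i j : I} (hij : i ≠ j) (m n : ℤ) :
    ⁅xp A ε i m, xm A ε j n⁆ = 0 := by
  have h := proj_eq_zero (A := A) (ε := ε) (.inr ⟨((i, m), (j, n)), rfl⟩)
  simp only [if_neg hij, sub_zero] at h
  exact h

theorem xp_lie_xm_self (i : I) (m n : ℤ) :
    ⁅xp A ε i m, xm A ε i n⁆ = proj A ε (DFree.H i (m + n)) +
      (if m + n = 0 then (m : ℂ) / (ε i : ℂ) else 0) • proj A ε (DFree.C I) := by
  have h := proj_eq_zero (A := A) (ε := ε) (.inr ⟨((i, m), (i, n)), rfl⟩)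
  simp only [if_true, proj_sub] at h
  exact sub_eq_zero.1 h

theorem mk_locality_eq_zero {z : DTilde A ε} (hz : z ∈ localityRels A ε) :
    LieSubmodule.Quotient.mk' (localityIdeal A ε) z = 0 :=
  (LieSubmodule.Quotient.mk_eq_zero _).2 (LieSubmodule.subset_lieSpan hz)

theorem xp_locality (i j : I) (m n : ℤ) (hij : A i j ≠ 0) :
    ⁅xp A ε i (m + 1), xp A ε j n⁆ = ⁅xp A ε i m, xp A ε j (n + 1)⁆ :=
  sub_eq_zero.1 (mk_locality_eq_zero (A := A) (ε := ε) (.inl ⟨i, j, m, n, hij, .inl rfl⟩))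

theorem xm_locality (i j : I) (m n : ℤ) (hij : A i j ≠ 0) :
    ⁅xm A ε i (m + 1), xm A ε j n⁆ = ⁅xm A ε i m, xm A ε j (n + 1)⁆ :=
  sub_eq_zero.1 (mk_locality_eq_zero (A := A) (ε := ε) (.inl ⟨i, j, m, n, hij, .inr rfl⟩))

theorem c_lie_xp (i : I) (m : ℤ) : ⁅proj A ε (DFree.C I), xp A ε i m⁆ = 0 := by
  rw [← lie_skew, xp_lie_c, neg_zero]

theorem c_lie_xm (i : I) (m : ℤ) : ⁅proj A ε (DFree.C I), xm A ε i m⁆ = 0 := by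
  rw [← lie_skew, xm_lie_c, neg_zero]

theorem xp_lie_xm_lie_xp (i j : I) (m p n : ℤ) :
    ⁅⁅xp A ε i m, xm A ε i p⁆, xp A ε j n⁆ = (A i j : ℂ) • xp A ε j (m + p + n) := by
  rw [xp_lie_xm_self, add_lie, smul_lie, c_lie_xp, smul_zero, add_zero, h_lie_xp]

theorem xm_lie_xp_lie_xm (i j : I) (m p n : ℤ) :
    ⁅⁅xm A ε i m, xp A ε i p⁆, xm A ε j n⁆ = (A i j : ℂ) • xm A ε j (m + p + n) := by
  rw [← lie_skew (xm A ε i m), xp_lie_xm_self, neg_lie, add_lie, smul_lie, c_lie_xm, smul_zero,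
    add_zero, h_lie_xm, neg_neg, add_comm p m]

end DHat

section Stmt12

variable {I : Type} [Fintype I] [DecidableEq I] (A : I → I → ℤ) (ε : I → ℚ)

/-- if `A` is of finite or affine type and not of type `A₁⁽¹⁾`, then in `D̂`,
for every `(i,j)` with `a_{ij} < 0`, with `b = 1 − a_{ij}`,
`[[x^±_{i,m₁}, [x^±_{i,m₂}, [⋯, [x^±_{i,m_b}, x^±_{j,n}]⋯]]], x^∓_{k,p}] = 0`. -/
theorem stmt12 (hGCM : IsGCM A) (hFA : IsFinOrAffType A)
    (hnotA11 : ¬(Fintype.card I = 2 ∧ ∀ i j, i ≠ j → A i j = -2))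
    (hε : ∀ i, 0 < ε i)
    (hsym : ∀ i j, (ε i : ℚ) * (A i j : ℚ) = (ε j : ℚ) * (A j i : ℚ))
    (i j : I) (hij : A i j < 0) (k : I)
    (m : Fin (1 - A i j).toNat → ℤ) (n p : ℤ) :
    ⁅iterBracket (List.ofFn fun t => DHat.xp A ε i (m t)) (DHat.xp A ε j n),
        DHat.xm A ε k p⁆ = 0 ∧
    ⁅iterBracket (List.ofFn fun t => DHat.xm A ε i (m t)) (DHat.xm A ε j n),
        DHat.xp A ε k p⁆ = 0 :=
  ⟨serre_lie_eq_zero hGCM DHat.xp_locality (fun _ _ m p h => DHat.xp_lie_xm_of_ne h m p)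
      DHat.xp_lie_xm_lie_xp hij k m n p,
    serre_lie_eq_zero hGCM DHat.xm_locality
      (fun _ _ m p h => by rw [← lie_skew, DHat.xp_lie_xm_of_ne h.symm, neg_zero])
      DHat.xm_lie_xp_lie_xm hij k m n p⟩

end Stmt12
end

section
/- Assume A is a generalized Cartan matrix of finite or affine type that is not of type A₁⁽¹⁾. Let D be the quotient of the presented Lie algebra D̃ by the Lie ideal generated by the following elements, for both signs ±: (locality) [x^±_{i,m+1}, x^±_{j,n}] − [x^±_{i,m}, x^±_{j,n+1}] for all i, j with a_{ij} ≠ 0, and [x^±_{i,m}, x^±_{j,n}] for all i, j with a_{ij} = 0; (Serre) [x^±_{i,m_1}, [x^±_{i,m_2}, [⋯, [x^±_{i,m_b}, x^±_{j,n}] ⋯]]] for all i, j with a_{ij} < 0, where b = 1 − a_{ij}, and all m_1, …, m_b, n ∈ ℤ. Let F⁺ be the Lie algebra over ℂ presented by generators y_{i,m} (i ∈ I, m ∈ ℤ) subject to the relations: [y_{i,m+1}, y_{j,n}] = [y_{i,m}, y_{j,n+1}] if a_{ij} ≠ 0; [y_{i,m}, y_{j,n}] = 0 if a_{ij} = 0;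 and [y_{i,m_1}, [⋯, [y_{i,m_b}, y_{j,n}] ⋯]] = 0 if a_{ij} < 0 with b = 1 − a_{ij}. Then the unique Lie algebra homomorphism F⁺ → D sending y_{i,m} to x⁺_{i,m} is injective, and its image is the Lie subalgebra of D generated by the elements x⁺_{i,m}. The analogous statement holds with x⁻_{i,m} in place of x⁺_{i,m}. -/
section Stmt13

variable {I : Type} [Fintype I] [DecidableEq I] (A : I → I → ℤ) (ε : I → ℚ)

/-- The locality and Serre relations imposed on `D̃`. -/
noncomputable def locSerreRels : Set (DTilde A ε) :=
  -- locality
  {z | ∃ (i j : I) (m n : ℤ), A i j ≠ 0 ∧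
      (z = ⁅DTilde.xp A ε i (m + 1), DTilde.xp A ε j n⁆ -
            ⁅DTilde.xp A ε i m, DTilde.xp A ε j (n + 1)⁆ ∨
        z = ⁅DTilde.xm A ε i (m + 1), DTilde.xm A ε j n⁆ -
            ⁅DTilde.xm A ε i m, DTilde.xm A ε j (n + 1)⁆)} ∪
  {z | ∃ (i j : I) (m n : ℤ), A i j = 0 ∧
      (z = ⁅DTilde.xp A ε i m, DTilde.xp A ε j n⁆ ∨
        z = ⁅DTilde.xm A ε i m, DTilde.xm A ε j n⁆)} ∪
  -- Serre
  {z | ∃ (i j : I), A i j < 0 ∧ ∃ (m : Fin (1 - A i j).toNat → ℤ) (n : ℤ),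
      (z = iterBracket (List.ofFn fun t => DTilde.xp A ε i (m t)) (DTilde.xp A ε j n) ∨
        z = iterBracket (List.ofFn fun t => DTilde.xm A ε i (m t)) (DTilde.xm A ε j n))}

noncomputable def locSerreIdeal : LieIdeal ℂ (DTilde A ε) :=
  LieSubmodule.lieSpan ℂ (DTilde A ε) (locSerreRels A ε)

/-- The presented Lie algebra `D` of Statement 13. -/
abbrev DAlg : Type := DTilde A ε ⧸ locSerreIdeal A ε

noncomputable def DAlg.xp (i : I) (m : ℤ) : DAlg A ε :=
  LieSubmodule.Quotient.mk' (locSerreIdeal A ε) (DTilde.xp A ε i m)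

noncomputable def DAlg.xm (i : I) (m : ℤ) : DAlg A ε :=
  LieSubmodule.Quotient.mk' (locSerreIdeal A ε) (DTilde.xm A ε i m)

/-- The relations defining the presented Lie algebra `F⁺` (equivalently `F⁻`):
locality and Serre relations in the generators `y_{i,m}`. -/
noncomputable def yRels : Set (FreeLieAlgebra ℂ (I × ℤ)) :=
  {z | ∃ (i j : I) (m n : ℤ), A i j ≠ 0 ∧
      z = ⁅FreeLieAlgebra.of ℂ ((i, m + 1) : I × ℤ), FreeLieAlgebra.of ℂ ((j, n) : I × ℤ)⁆ -
          ⁅FreeLieAlgebra.of ℂ ((i, m) : I × ℤ), FreeLieAlgebra.of ℂ ((j, n + 1) : I × ℤ)⁆} ∪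
  {z | ∃ (i j : I) (m n : ℤ), A i j = 0 ∧
      z = ⁅FreeLieAlgebra.of ℂ ((i, m) : I × ℤ), FreeLieAlgebra.of ℂ ((j, n) : I × ℤ)⁆} ∪
  {z | ∃ (i j : I), A i j < 0 ∧ ∃ (m : Fin (1 - A i j).toNat → ℤ) (n : ℤ),
      z = iterBracket (List.ofFn fun t => FreeLieAlgebra.of ℂ ((i, m t) : I × ℤ))
            (FreeLieAlgebra.of ℂ ((j, n) : I × ℤ))}

noncomputable def yIdeal : LieIdeal ℂ (FreeLieAlgebra ℂ (I × ℤ)) :=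
  LieSubmodule.lieSpan ℂ (FreeLieAlgebra ℂ (I × ℤ)) (yRels A)

/-- The presented Lie algebra `F⁺` (equivalently `F⁻`). -/
abbrev FPres : Type := FreeLieAlgebra ℂ (I × ℤ) ⧸ yIdeal A

noncomputable def FPres.y (i : I) (m : ℤ) : FPres A :=
  LieSubmodule.Quotient.mk' (yIdeal A) (FreeLieAlgebra.of ℂ ((i, m) : I × ℤ))

end Stmt13

/-! ### Local families and iterated brackets -/

section Local

variable {I L M : Type} [LieRing L] [LieRing M]

/-- The locality relations for a family `y_{i,m}`. -/
structure IsLocal (A : I → I → ℤ) (y : I → ℤ → L) : Prop where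
  loc : ∀ i j m n, A i j ≠ 0 → ⁅y i (m + 1), y j n⁆ = ⁅y i m, y j (n + 1)⁆
  comm : ∀ i j m n, A i j = 0 → ⁅y i m, y j n⁆ = 0

/-- The locality and Serre relations for a family `y_{i,m}`. -/
structure IsLocalSerre (A : I → I → ℤ) (y : I → ℤ → L) : Prop extends IsLocal A y where
  serre : ∀ i j, A i j < 0 → ∀ (m : Fin (1 - A i j).toNat → ℤ) (n : ℤ),
    iterBracket (List.ofFn fun t => y i (m t)) (y j n) = 0

/-- The iterated bracket `(ad y_{i,0})^r y_{j,s}`. -/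
def adPow (y : I → ℤ → L) (i j : I) : ℕ → ℤ → L
  | 0, s => y j s
  | r + 1, s => ⁅y i 0, adPow y i j r s⁆

variable {A : I → I → ℤ}

namespace IsLocal

variable {y : I → ℤ → L}

theorem lie_eq (hy : IsLocal A y) {i j : I} (hij : A i j ≠ 0) (m n : ℤ) :
    ⁅y i m, y j n⁆ = ⁅y i 0, y j (m + n)⁆ := by
  induction m generalizing n with
  | zero => simp
  | succ k ih => rw [hy.loc i j _ _ hij, ih, show (k : ℤ) + (n + 1) = k + 1 + n by ring]
  | pred k ih =>
    have h := hy.loc i j (-(k : ℤ) - 1) (n - 1) hij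
    rw [sub_add_cancel, sub_add_cancel] at h
    rw [← h, ih, show -(k : ℤ) + (n - 1) = -k - 1 + n by ring]

variable [LieAlgebra ℂ L]

theorem lie_self_index (hy : IsLocal A y) {i : I} (hi : A i i ≠ 0) (m n : ℤ) :
    ⁅y i m, y i n⁆ = 0 := by
  have h : ⁅y i m, y i n⁆ = -⁅y i m, y i n⁆ := by
    rw [lie_skew, hy.lie_eq hi, hy.lie_eq hi n m, add_comm]
  have h2 : (2 : ℂ) • ⁅y i m, y i n⁆ = 0 := by rw [two_smul]; nth_rw 1 [h]; exact neg_add_cancel _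
  exact (smul_eq_zero_iff_right two_ne_zero).1 h2

theorem lie_adPow (hy : IsLocal A y) {i j : I} (hi : A i i ≠ 0) (hij : A i j ≠ 0) (m : ℤ)
    (r : ℕ) (s : ℤ) : ⁅y i m, adPow y i j r s⁆ = adPow y i j (r + 1) (m + s) := by
  induction r with
  | zero => exact hy.lie_eq hij m s
  | succ r ih =>
    rw [adPow, leibniz_lie, hy.lie_self_index hi, zero_lie, zero_add, ih]
    rfl

theorem iterBracket_eq (hy : IsLocal A y) {i j : I} (hi : A i i ≠ 0) (hij : A i j ≠ 0)
    (l : List ℤ) (n : ℤ) :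
    iterBracket (l.map (y i)) (y j n) = adPow y i j l.length (l.sum + n) := by
  induction l with
  | nil => simp [iterBracket, adPow]
  | cons m l ih =>
    simp only [iterBracket, List.map_cons, List.foldr_cons, List.length_cons,
      List.sum_cons] at ih ⊢
    rw [ih, hy.lie_adPow hi hij, add_assoc]

theorem isLocalSerre_iff (hA : ∀ i, A i i = 2) (hy : IsLocal A y) :
    IsLocalSerre A y ↔ ∀ i j, A i j < 0 → ∀ s, adPow y i j (1 - A i j).toNat s = 0 := by
  have hi (i : I) : A i i ≠ 0 := by simp [hA]
  have key (i j : I) (hij : A i j < 0) (m : Fin (1 - A i j).toNat → ℤ) (n : ℤ) :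
      iterBracket (List.ofFn fun t => y i (m t)) (y j n) =
        adPow y i j (1 - A i j).toNat ((List.ofFn m).sum + n) := by
    have := hy.iterBracket_eq (hi i) hij.ne (List.ofFn m) n
    rwa [List.map_ofFn, List.length_ofFn] at this
  constructor
  · intro h i j hij s
    have := h.serre i j hij 0 s
    rw [key i j hij] at this
    simpa [List.sum_ofFn] using this
  · intro h
    exact { hy with serre := fun i j hij m n => by rw [key i j hij, h i j hij] }

/-- An element acting on `y_{i,•}` and `y_{j,•}` by scaled shifts so acts on `adPow`. -/
theorem lie_adPow_of_shift (hy : IsLocal A y) {i j : I} (hi : A i i = 2) (hij : A i j ≠ 0)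
    {h : L} {m : ℤ} (hyi : ∀ n, ⁅h, y i n⁆ = (2 : ℂ) • y i (m + n))
    (hyj : ∀ n, ⁅h, y j n⁆ = (A i j : ℂ) • y j (m + n)) (r : ℕ) (s : ℤ) :
    ⁅h, adPow y i j r s⁆ = ((A i j : ℂ) + 2 * r) • adPow y i j r (m + s) := by
  induction r with
  | zero => simp [adPow, hyj]
  | succ r ih =>
    rw [adPow, leibniz_lie, hyi, ih, smul_lie, lie_smul, add_zero,
      hy.lie_adPow (by simp [hi]) hij, ← adPow, ← add_smul]
    congr 1
    push_cast
    ring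

end IsLocal

variable [LieAlgebra ℂ L] [LieAlgebra ℂ M]

theorem map_iterBracket (f : L →ₗ⁅ℂ⁆ M) (l : List L) (x : L) :
    f (iterBracket l x) = iterBracket (l.map f) (f x) := by
  induction l with
  | nil => rfl
  | cons u l ih => simpa [iterBracket] using congrArg _ ih

theorem map_adPow (f : L →ₗ⁅ℂ⁆ M) (y : I → ℤ → L) (i j : I) (r : ℕ) (s : ℤ) :
    f (adPow y i j r s) = adPow (fun i m => f (y i m)) i j r s := by
  induction r with
  | zero => rfl
  | succ r ih => rw [adPow, LieHom.map_lie, ih, adPow]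

theorem IsLocalSerre.map {y : I → ℤ → L} (hy : IsLocalSerre A y) (f : L →ₗ⁅ℂ⁆ M) :
    IsLocalSerre A fun i m => f (y i m) where
  loc i j m n h := by rw [← LieHom.map_lie, hy.loc i j m n h, LieHom.map_lie]
  comm i j m n h := by rw [← LieHom.map_lie, hy.comm i j m n h, map_zero]
  serre i j h m n := by
    have := congrArg f (hy.serre i j h m n)
    rwa [map_iterBracket, List.map_ofFn, map_zero] at this

/-! ### Derivations along a homomorphism -/

/-- `g` is a derivation along the Lie algebra homomorphism `f`. -/
def IsDerivAlong (f : L →ₗ⁅ℂ⁆ M) (g : L →ₗ[ℂ] M) : Prop :=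
  ∀ a b, g ⁅a, b⁆ = ⁅f a, g b⁆ + ⁅g a, f b⁆

namespace IsDerivAlong

variable {f : L →ₗ⁅ℂ⁆ M} {g : L →ₗ[ℂ] M} {y : I → ℤ → L}

theorem _root_.IsLocal.of_jointly_faithful (hfg : ∀ x, f x = 0 → g x = 0 → x = 0)
    (hf : IsLocal A fun i m => f (y i m))
    (hloc : ∀ i j m n, A i j ≠ 0 → g ⁅y i (m + 1), y j n⁆ = g ⁅y i m, y j (n + 1)⁆)
    (hcomm : ∀ i j m n, A i j = 0 → g ⁅y i m, y j n⁆ = 0) : IsLocal A y where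
  loc i j m n h := by
    refine sub_eq_zero.1 (hfg _ ?_ ?_)
    · simp [hf.loc i j m n h]
    · rw [map_sub, hloc i j m n h, sub_self]
  comm i j m n h := hfg _ (by simpa using hf.comm i j m n h) (hcomm i j m n h)

section Scale

variable {a : I → ℂ} {k : ℤ}

theorem scale_loc (hg : IsDerivAlong f g) (hf : IsLocal A fun i m => f (y i m))
    (hy : ∀ i m, g (y i m) = a i • f (y i (k + m))) (i j : I) (m n : ℤ) (h : A i j ≠ 0) :
    g ⁅y i (m + 1), y j n⁆ = g ⁅y i m, y j (n + 1)⁆ := by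
  simp only [hg _ _, hy, lie_smul, smul_lie]
  rw [hf.lie_eq h (m + 1), hf.lie_eq h (k + (m + 1)), hf.lie_eq h m, hf.lie_eq h (k + m)]
  ring_nf

theorem scale_comm (hg : IsDerivAlong f g) (hf : IsLocal A fun i m => f (y i m))
    (hy : ∀ i m, g (y i m) = a i • f (y i (k + m))) (i j : I) (m n : ℤ) (h : A i j = 0) :
    g ⁅y i m, y j n⁆ = 0 := by
  simp only [hg _ _, hy, lie_smul, smul_lie]
  rw [hf.comm i j _ _ h, hf.comm i j _ _ h]
  simp

theorem scale_adPow (hg : IsDerivAlong f g) (hf : IsLocal A fun i m => f (y i m))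
    (hy : ∀ i m, g (y i m) = a i • f (y i (k + m))) {i j : I} (hi : A i i ≠ 0)
    (h : A i j ≠ 0) (r : ℕ) (s : ℤ) :
    g (adPow y i j r s) =
      (r * a i + a j) • adPow (fun i m => f (y i m)) i j r (k + s) := by
  induction r with
  | zero => simp [adPow, hy]
  | succ r ih =>
    rw [adPow, hg, ih, hy, lie_smul, smul_lie, map_adPow, hf.lie_adPow hi h,
      hf.lie_adPow hi h, zero_add, add_assoc, zero_add, ← add_smul]
    congr 1
    push_cast
    ring

theorem scale_isLocalSerre (hg : IsDerivAlong f g) (hfg : ∀ x, f x = 0 → g x = 0 → x = 0)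
    (hA : ∀ i, A i i = 2) (hf : IsLocalSerre A fun i m => f (y i m))
    (hy : ∀ i m, g (y i m) = a i • f (y i (k + m))) : IsLocalSerre A y := by
  have hl := IsLocal.of_jointly_faithful hfg hf.toIsLocal (hg.scale_loc hf.toIsLocal hy)
    (hg.scale_comm hf.toIsLocal hy)
  have hs := (hf.toIsLocal.isLocalSerre_iff hA).1 hf
  refine (hl.isLocalSerre_iff hA).2 fun i j hij s => hfg _ ?_ ?_
  · rw [map_adPow, hs i j hij]
  · rw [hg.scale_adPow hf.toIsLocal hy (by simp [hA]) hij.ne, hs i j hij, smul_zero]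

end Scale

section Contract

variable [DecidableEq I] {h : I → ℤ → M} {k : I} {l : ℤ}

theorem contract_loc (hg : IsDerivAlong f g)
    (hh : ∀ i j m n, ⁅h i m, f (y j n)⁆ = (A i j : ℂ) • f (y j (m + n)))
    (hy : ∀ i m, g (y i m) = if i = k then h i (m + l) else 0) (i j : I) (m n : ℤ) :
    g ⁅y i (m + 1), y j n⁆ = g ⁅y i m, y j (n + 1)⁆ := by
  have hh' (i j m n) : ⁅f (y j n), h i m⁆ = -((A i j : ℂ) • f (y j (m + n))) := by
    rw [← lie_skew, hh]
  simp only [hg _ _, hy]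
  split_ifs <;> simp only [hh, hh', lie_zero, zero_lie] <;> ring_nf

theorem contract_comm (hg : IsDerivAlong f g)
    (hh : ∀ i j m n, ⁅h i m, f (y j n)⁆ = (A i j : ℂ) • f (y j (m + n)))
    (hy : ∀ i m, g (y i m) = if i = k then h i (m + l) else 0) {i j : I} (m n : ℤ)
    (hij : A i j = 0) (hji : A j i = 0) : g ⁅y i m, y j n⁆ = 0 := by
  have hh' (i j m n) : ⁅f (y j n), h i m⁆ = -((A i j : ℂ) • f (y j (m + n))) := by
    rw [← lie_skew, hh]
  simp only [hg _ _, hy]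
  split_ifs <;> simp [hh, hh', hij, hji]

theorem contract_adPow_same (hg : IsDerivAlong f g) (hf : IsLocal A fun i m => f (y i m))
    (hh : ∀ i j m n, ⁅h i m, f (y j n)⁆ = (A i j : ℂ) • f (y j (m + n)))
    (hy : ∀ i m, g (y i m) = if i = k then h i (m + l) else 0) {j : I} (hk : A k k = 2)
    (hj : j ≠ k) (hkj : A k j ≠ 0) (r : ℕ) (s : ℤ) :
    g (adPow y k j (r + 1) s) =
      ((r + 1) * (A k j + r) : ℂ) • adPow (fun i m => f (y i m)) k j r (l + s) := by
  induction r with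
  | zero => simp [adPow, hg _ _, hy, hj, hh]
  | succ r ih =>
    have hsh := hf.lie_adPow_of_shift hk hkj (h := h k l) (m := l)
      (fun n => by simpa [hk] using hh k k l n) (fun n => hh k j l n) (r + 1) s
    rw [adPow, hg, ih, hy, if_pos rfl, zero_add, map_adPow, hsh, lie_smul,
      hf.lie_adPow (by simp [hk]) hkj, zero_add, ← add_smul]
    congr 1
    push_cast
    ring

theorem contract_adPow_ne (hg : IsDerivAlong f g) (hf : IsLocal A fun i m => f (y i m))
    (hh : ∀ i j m n, ⁅h i m, f (y j n)⁆ = (A i j : ℂ) • f (y j (m + n)))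
    (hy : ∀ i m, g (y i m) = if i = k then h i (m + l) else 0) {i j : I} (hi : A i i ≠ 0)
    (hik : i ≠ k) (r : ℕ) (s : ℤ) : g (adPow y i j (r + 2) s) = 0 := by
  have hstep (r : ℕ) (s : ℤ) : g (adPow y i j (r + 1) s) = ⁅f (y i 0), g (adPow y i j r s)⁆ := by
    rw [adPow, hg, hy, if_neg hik, zero_lie, add_zero]
  induction r with
  | zero =>
    rw [hstep, hstep, adPow, hy]
    split_ifs
    · rw [← lie_skew (f _) (h j _), hh, lie_neg, lie_smul, hf.lie_self_index hi, smul_zero, neg_zero]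
    · simp
  | succ r ih => rw [hstep, ih, lie_zero]

theorem contract_serre (hg : IsDerivAlong f g) (hA : ∀ i, A i i = 2)
    (hf : IsLocal A fun i m => f (y i m))
    (hh : ∀ i j m n, ⁅h i m, f (y j n)⁆ = (A i j : ℂ) • f (y j (m + n)))
    (hy : ∀ i m, g (y i m) = if i = k then h i (m + l) else 0) {i j : I} (hij : A i j < 0)
    (s : ℤ) : g (adPow y i j (1 - A i j).toNat s) = 0 := by
  obtain ⟨r, hr⟩ : ∃ r : ℕ, A i j = -(r + 1 : ℤ) := ⟨(-A i j - 1).toNat, by omega⟩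
  rw [show (1 - A i j).toNat = r + 2 by omega]
  by_cases hik : i = k
  · subst hik
    have hj : j ≠ i := by rintro rfl; simp [hA] at hij
    rw [hg.contract_adPow_same hf hh hy (hA i) hj hij.ne (r + 1), hr]
    simp
  · exact hg.contract_adPow_ne hf hh hy (by simp [hA]) hik r s

theorem contract_isLocalSerre (hg : IsDerivAlong f g) (hfg : ∀ x, f x = 0 → g x = 0 → x = 0)
    (hA : ∀ i, A i i = 2) (hA0 : ∀ i j, A i j = 0 → A j i = 0)
    (hf : IsLocalSerre A fun i m => f (y i m))
    (hh : ∀ i j m n, ⁅h i m, f (y j n)⁆ = (A i j : ℂ) • f (y j (m + n)))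
    (hy : ∀ i m, g (y i m) = if i = k then h i (m + l) else 0) : IsLocalSerre A y := by
  have hl : IsLocal A y := IsLocal.of_jointly_faithful hfg hf.toIsLocal
    (fun i j m n _ => hg.contract_loc hh hy i j m n)
    (fun i j m n hij => hg.contract_comm hh hy m n hij (hA0 i j hij))
  refine (hl.isLocalSerre_iff hA).2 fun i j hij s => hfg _ ?_ ?_
  · rw [map_adPow, (hf.toIsLocal.isLocalSerre_iff hA).1 hf i j hij]
  · exact hg.contract_serre hA hf.toIsLocal hh hy hij s

end Contract

theorem ad (z : L) : IsDerivAlong LieHom.id (LieAlgebra.ad ℂ L z : L →ₗ[ℂ] L) := fun a b => by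
  simp only [LieAlgebra.ad_apply, LieHom.id_apply]
  rw [leibniz_lie, add_comm]

end IsDerivAlong

end Local

/-! ### Universal properties of the presented algebras -/

section QuotientHom

variable {L M : Type} [LieRing L] [LieAlgebra ℂ L] [LieRing M] [LieAlgebra ℂ M]

/-- The quotient map by a Lie ideal, as a homomorphism of Lie algebras. -/
def LieIdeal.quotHom (J : LieIdeal ℂ L) : L →ₗ⁅ℂ⁆ L ⧸ J where
  toLinearMap := (LieSubmodule.Quotient.mk' J : L →ₗ[ℂ] L ⧸ J)
  map_lie' := fun {x y} => LieSubmodule.Quotient.mk_bracket J x y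

theorem LieIdeal.quotHom_apply (J : LieIdeal ℂ L) (x : L) :
    J.quotHom x = LieSubmodule.Quotient.mk' J x := rfl

/-- A homomorphism vanishing on a set factors through the quotient by the ideal it generates. -/
theorem LieIdeal.exists_quotient_lift (f : L →ₗ⁅ℂ⁆ M) {J : LieIdeal ℂ L} {s : Set L}
    (hJ : J = LieSubmodule.lieSpan ℂ L s) (hs : ∀ x ∈ s, f x = 0) :
    ∃ F : (L ⧸ J) →ₗ⁅ℂ⁆ M, ∀ x, F (LieSubmodule.Quotient.mk' J x) = f x := by
  have hle : J ≤ f.ker :=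
    hJ ▸ LieSubmodule.lieSpan_le.2 fun x hx => (LieHom.mem_ker (f := f)).2 (hs x hx)
  let F : (L ⧸ J) →ₗ[ℂ] M :=
    J.toSubmodule.liftQ f fun x hx => (LieHom.mem_ker (f := f)).1 (hle hx)
  have hF (x) : F (LieSubmodule.Quotient.mk' J x) = f x := rfl
  refine ⟨{ F with map_lie' := fun {a b} => ?_ }, hF⟩
  obtain ⟨a, rfl⟩ := LieSubmodule.Quotient.surjective_mk' _ a
  obtain ⟨b, rfl⟩ := LieSubmodule.Quotient.surjective_mk' _ b
  exact LieHom.map_lie f a b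

end QuotientHom

section FPres

variable {I L : Type} [LieRing L] [LieAlgebra ℂ L] {A : I → I → ℤ}

theorem isLocalSerre_y (A : I → I → ℤ) : IsLocalSerre A (FPres.y A) := by
  have hz {z} (hz : z ∈ yRels A) : (yIdeal A).quotHom z = 0 :=
    (LieSubmodule.Quotient.mk_eq_zero _).2 (LieSubmodule.subset_lieSpan hz)
  refine ⟨⟨fun i j m n h => sub_eq_zero.1 ?_, fun i j m n h => ?_⟩, fun i j h m n => ?_⟩
  · have := hz (Or.inl (Or.inl ⟨i, j, m, n, h, rfl⟩))
    rwa [map_sub, LieHom.map_lie, LieHom.map_lie] at this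
  · have := hz (Or.inl (Or.inr ⟨i, j, m, n, h, rfl⟩))
    rwa [LieHom.map_lie] at this
  · have := hz (Or.inr ⟨i, j, h, m, n, rfl⟩)
    rwa [map_iterBracket, List.map_ofFn] at this

theorem FPres.exists_lift {y : I → ℤ → L} (hy : IsLocalSerre A y) :
    ∃ F : FPres A →ₗ⁅ℂ⁆ L, ∀ i m, F (FPres.y A i m) = y i m := by
  let f : FreeLieAlgebra ℂ (I × ℤ) →ₗ⁅ℂ⁆ L := FreeLieAlgebra.lift ℂ fun p => y p.1 p.2
  have hf (i m) : f (FreeLieAlgebra.of ℂ (i, m)) = y i m := FreeLieAlgebra.lift_of_apply ..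
  obtain ⟨F, hF⟩ := LieIdeal.exists_quotient_lift f (J := yIdeal A) rfl (by
    rintro z ((⟨i, j, m, n, h, rfl⟩ | ⟨i, j, m, n, h, rfl⟩) | ⟨i, j, h, m, n, rfl⟩)
    · simp [hf, hy.loc i j m n h]
    · simp [hf, hy.comm i j m n h]
    · rw [map_iterBracket, List.map_ofFn, hf]
      simpa [Function.comp_def, hf] using hy.serre i j h m n)
  exact ⟨F, fun i m => (hF _).trans (hf i m)⟩

theorem FPres.eq_top_of_y_mem (K : LieSubalgebra ℂ (FPres A)) (hK : ∀ i m, FPres.y A i m ∈ K) :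
    K = ⊤ := by
  let f : FreeLieAlgebra ℂ (I × ℤ) →ₗ⁅ℂ⁆ K :=
    FreeLieAlgebra.lift ℂ fun p => ⟨FPres.y A p.1 p.2, hK p.1 p.2⟩
  have hf : K.incl.comp f = (yIdeal A).quotHom := by
    refine FreeLieAlgebra.hom_ext fun p => ?_
    rw [LieHom.comp_apply, FreeLieAlgebra.lift_of_apply]
    rfl
  refine eq_top_iff.2 fun x _ => ?_
  obtain ⟨x, rfl⟩ := LieSubmodule.Quotient.surjective_mk' _ x
  rw [← LieIdeal.quotHom_apply, ← hf]
  exact (f x).2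

theorem FPres.hom_ext {F G : FPres A →ₗ⁅ℂ⁆ L}
    (h : ∀ i m, F (FPres.y A i m) = G (FPres.y A i m)) : F = G := by
  let K : LieSubalgebra ℂ (FPres A) :=
    { LinearMap.eqLocus (F : FPres A →ₗ[ℂ] L) (G : FPres A →ₗ[ℂ] L) with
      lie_mem' := fun {a b} (ha : F a = G a) (hb : F b = G b) => show F _ = G _ by
        rw [LieHom.map_lie, LieHom.map_lie, ha, hb] }
  have hK := FPres.eq_top_of_y_mem K h
  ext x
  exact (hK ▸ LieSubalgebra.mem_top x : x ∈ K)

theorem FPres.range_eq {x : I → ℤ → L} (φ : FPres A →ₗ⁅ℂ⁆ L)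
    (hφ : ∀ i m, φ (FPres.y A i m) = x i m) :
    φ.range = LieSubalgebra.lieSpan ℂ L (Set.range fun p : I × ℤ => x p.1 p.2) := by
  apply le_antisymm
  · have := FPres.eq_top_of_y_mem
      ((LieSubalgebra.lieSpan ℂ L (Set.range fun p : I × ℤ => x p.1 p.2)).comap φ) fun i m => by
        rw [LieSubalgebra.mem_comap, hφ]
        exact LieSubalgebra.subset_lieSpan ⟨(i, m), rfl⟩
    rintro _ ⟨z, rfl⟩
    have hz : z ∈ (⊤ : LieSubalgebra ℂ (FPres A)) := LieSubalgebra.mem_top z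
    rw [← this] at hz
    exact hz
  · rw [LieSubalgebra.lieSpan_le]
    rintro _ ⟨p, rfl⟩
    exact ⟨FPres.y A p.1 p.2, hφ _ _⟩

end FPres

/-! ### `F⁺` embeds into its enveloping algebra -/

section Faithful

attribute [local instance] LieRing.ofAssociativeRing

variable {L : Type} [LieRing L] [LieAlgebra ℂ L]

/-- The operator `(z, c) ↦ ([w, z] + c r w, 0)`: the adjoint action of `w` on the extension of `L`
by a derivation acting on `w` as the scalar `r`. -/
def degreeOp (w : L) (r : ℂ) : Module.End ℂ (L × ℂ) :=
  LinearMap.inl ℂ L ℂ ∘ₗ LinearMap.coprod (LieAlgebra.ad ℂ L w : L →ₗ[ℂ] L)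
    (LinearMap.toSpanSingleton ℂ L (r • w))

theorem degreeOp_apply (w : L) (r : ℂ) (z : L × ℂ) :
    degreeOp w r z = (⁅w, z.1⁆ + z.2 • r • w, 0) := rfl

theorem degreeOp_lie (w w' : L) (r r' : ℂ) :
    ⁅degreeOp w r, degreeOp w' r'⁆ = degreeOp ⁅w, w'⁆ (r + r') := by
  refine LinearMap.ext fun z => ?_
  rw [LieRing.of_associative_ring_bracket, LinearMap.sub_apply, Module.End.mul_apply,
    Module.End.mul_apply]
  simp only [degreeOp_apply, zero_smul, add_zero, lie_add, lie_smul, Prod.mk_sub_mk, sub_zero,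
    Prod.mk.injEq, and_true]
  rw [lie_lie, ← lie_skew w w']
  module

theorem degreeOp_zero (r : ℂ) : degreeOp (0 : L) r = 0 :=
  LinearMap.ext fun z => by simp [degreeOp_apply]

theorem iterBracket_degreeOp (l : List L) (w : L) (r : ℂ) :
    iterBracket (l.map fun u => degreeOp u 1) (degreeOp w r) =
      degreeOp (iterBracket l w) (l.length + r) := by
  induction l with
  | nil => simp [iterBracket]
  | cons u l ih =>
    simp only [iterBracket, List.map_cons, List.foldr_cons, List.length_cons] at ih ⊢
    rw [ih, degreeOp_lie]
    congr 1
    push_cast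
    ring

theorem IsLocalSerre.degreeOp {I : Type} {A : I → I → ℤ} {y : I → ℤ → L}
    (hy : IsLocalSerre A y) : IsLocalSerre A fun i m => degreeOp (y i m) 1 where
  loc i j m n h := by simp only [degreeOp_lie, hy.loc i j m n h]
  comm i j m n h := by simp only [degreeOp_lie, hy.comm i j m n h, degreeOp_zero]
  serre i j h m n := by
    have := iterBracket_degreeOp (List.ofFn fun t => y i (m t)) (y j n) 1
    rw [hy.serre i j h m n, degreeOp_zero, List.map_ofFn] at this
    exact this

/-- `F⁺` acts faithfully on its extension by the principal degree derivation. -/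
theorem FPres.exists_injective_end {I : Type} (A : I → I → ℤ) :
    ∃ F : FPres A →ₗ⁅ℂ⁆ Module.End ℂ (FPres A × ℂ), Function.Injective F := by
  obtain ⟨F, hF⟩ := FPres.exists_lift (isLocalSerre_y A).degreeOp
  refine ⟨F, (injective_iff_map_eq_zero F).2 fun x hx => ?_⟩
  let θ : Module.End ℂ (FPres A) := LinearMap.fst ℂ _ ℂ ∘ₗ
    LinearMap.applyₗ ((0, 1) : FPres A × ℂ) ∘ₗ (F : FPres A →ₗ[ℂ] Module.End ℂ (FPres A × ℂ))
  have hθ (x) : θ x = (F x (0, 1)).1 := rfl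
  let P (r : ℕ) : Submodule ℂ (FPres A) :=
    { carrier := {x | F x = degreeOp x (r + 1)}
      add_mem' := fun {a b} ha hb => by
        simp only [Set.mem_ofPred_eq] at *
        rw [map_add, ha, hb]
        ext z <;> simp [degreeOp_apply]
      zero_mem' := by simp [degreeOp_zero]
      smul_mem' := fun c a ha => by
        simp only [Set.mem_ofPred_eq] at *
        rw [map_smul, ha]
        ext z <;> simp [degreeOp_apply, smul_comm c] }
  have hP {r x} : x ∈ P r ↔ F x = degreeOp x (r + 1) := Iff.rfl
  let K : LieSubalgebra ℂ (FPres A) :=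
    { ⨆ r, P r with
      lie_mem' := fun {a b} (ha : a ∈ ⨆ r, P r) (hb : b ∈ ⨆ r, P r) =>
        show ⁅a, b⁆ ∈ ⨆ r, P r by
          induction ha using Submodule.iSup_induction' with
          | zero => simp
          | add a a' _ _ h h' => rw [add_lie]; exact add_mem h h'
          | mem r a ha =>
            induction hb using Submodule.iSup_induction' with
            | zero => simp
            | add b b' _ _ h h' => rw [lie_add]; exact add_mem h h'
            | mem s b hb =>
              refine Submodule.mem_iSup_of_mem (r + s + 1) (hP.2 ?_)
              rw [LieHom.map_lie, hP.1 ha, hP.1 hb, degreeOp_lie]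
              congr 1
              push_cast
              ring }
  have hK : K = ⊤ := FPres.eq_top_of_y_mem K fun i m =>
    Submodule.mem_iSup_of_mem (p := P) 0 (hP.2 (by simpa using hF i m))
  have hxK : x ∈ ⨆ r, P r := (hK ▸ LieSubalgebra.mem_top x : x ∈ K)
  have hle : ⨆ r, P r ≤ ⨆ (μ : ℂ) (_ : μ ≠ 0), θ.eigenspace μ := iSup_le fun r z hz => by
    have hr : (r + 1 : ℂ) ≠ 0 := Nat.cast_add_one_ne_zero r
    refine Submodule.mem_iSup_of_mem _ (Submodule.mem_iSup_of_mem hr ?_)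
    rw [Module.End.mem_eigenspace_iff, hθ, hP.1 hz]
    simp [degreeOp_apply]
  have hx0 : x ∈ θ.eigenspace 0 := by
    rw [Module.End.mem_eigenspace_iff, hθ, hx]
    simp
  exact Submodule.disjoint_def.1 (θ.eigenspaces_iSupIndep 0) x hx0 (hle hxK)

theorem FPres.injective_ι {I : Type} (A : I → I → ℤ) :
    Function.Injective (UniversalEnvelopingAlgebra.ι ℂ : FPres A →ₗ⁅ℂ⁆ _) := by
  obtain ⟨F, hF⟩ := FPres.exists_injective_end A
  refine Function.Injective.of_comp (f := UniversalEnvelopingAlgebra.lift ℂ F) ?_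
  rwa [UniversalEnvelopingAlgebra.ι_comp_lift]

end Faithful

/-! ### The level zero vacuum module -/

section Vacuum

attribute [local instance] LieRing.ofAssociativeRing

open UniversalEnvelopingAlgebra

/-- Families satisfying the defining relations of `D` with `c` acting by zero. -/
structure IsLevelZero {I L : Type} [DecidableEq I] [LieRing L] [LieAlgebra ℂ L]
    (A : I → I → ℤ) (h xp xm : I → ℤ → L) : Prop where
  hh : ∀ i j m n, ⁅h i m, h j n⁆ = 0
  hp : ∀ i j m n, ⁅h i m, xp j n⁆ = (A i j : ℂ) • xp j (m + n)
  hm : ∀ i j m n, ⁅h i m, xm j n⁆ = -((A i j : ℂ) • xm j (m + n))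
  pm : ∀ i j m n, ⁅xp i m, xm j n⁆ = if i = j then h j (m + n) else 0
  isLocalSerre_p : IsLocalSerre A xp
  isLocalSerre_m : IsLocalSerre A xm

theorem IsLevelZero.swap {I L : Type} [DecidableEq I] [LieRing L] [LieAlgebra ℂ L]
    {A : I → I → ℤ} {h xp xm : I → ℤ → L} (H : IsLevelZero A h xp xm) :
    IsLevelZero A (fun i m => -h i m) xm xp where
  hh i j m n := by simp [H.hh]
  hp i j m n := by simp [H.hm]
  hm i j m n := by simp [H.hp]
  pm i j m n := by
    rw [← lie_skew, H.pm]
    by_cases hij : i = j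
    · subst hij
      simp [add_comm]
    · simp [hij, Ne.symm hij]
  isLocalSerre_p := H.isLocalSerre_m
  isLocalSerre_m := H.isLocalSerre_p

section DualNumber

variable {R : Type} [Ring R] [Algebra ℂ R]

/-- The derivation `a + b ε ↦ b` along `a + b ε ↦ a`. -/
theorem isDerivAlong_fst_snd :
    IsDerivAlong (TrivSqZeroExt.fstHom ℂ R R).toLieHom
      ((TrivSqZeroExt.sndHom R R).restrictScalars ℂ) := fun a b => by
  simp only [LieRing.of_associative_ring_bracket, LinearMap.coe_restrictScalars,
    TrivSqZeroExt.sndHom_apply, AlgHom.toLieHom_apply, TrivSqZeroExt.fstHom_apply,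
    TrivSqZeroExt.snd_sub, DualNumber.snd_mul]
  abel

theorem eq_zero_of_fst_snd (x : DualNumber R) (h : (TrivSqZeroExt.fstHom ℂ R R).toLieHom x = 0)
    (h' : (TrivSqZeroExt.sndHom R R).restrictScalars ℂ x = 0) : x = 0 :=
  TrivSqZeroExt.ext h h'

theorem fst_inl_add_inr (a b : R) : (TrivSqZeroExt.fstHom ℂ R R).toLieHom
    (TrivSqZeroExt.inl a + TrivSqZeroExt.inr b : DualNumber R) = a :=
  add_zero a

theorem snd_inl_add_inr (a b : R) : (TrivSqZeroExt.sndHom R R).restrictScalars ℂ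
    (TrivSqZeroExt.inl a + TrivSqZeroExt.inr b : DualNumber R) = b :=
  zero_add b

end DualNumber

variable {I : Type} (A : I → I → ℤ)

/-- The enveloping algebra of `F⁺`, on which `D` acts as on a vacuum module. -/
abbrev VacuumModule : Type := UniversalEnvelopingAlgebra ℂ (FPres A)

/-- Left multiplication by `y_{i,m}`. -/
noncomputable def mulY (i : I) (m : ℤ) : Module.End ℂ (VacuumModule A) :=
  Algebra.lmul ℂ (VacuumModule A) (ι ℂ (FPres.y A i m))

theorem isLocalSerre_mulY : IsLocalSerre A (mulY A) :=
  (isLocalSerre_y A).map ((Algebra.lmul ℂ (VacuumModule A)).toLieHom.comp (ι ℂ))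

variable {A}

theorem mulY_apply (i : I) (m : ℤ) (u : VacuumModule A) :
    mulY A i m u = ι ℂ (FPres.y A i m) * u := rfl

theorem VacuumModule.algHom_ext {R : Type} [Ring R] [Algebra ℂ R] {F G : VacuumModule A →ₐ[ℂ] R}
    (h : ∀ i m, F (ι ℂ (FPres.y A i m)) = G (ι ℂ (FPres.y A i m))) : F = G :=
  UniversalEnvelopingAlgebra.hom_ext ℂ (FPres.hom_ext h)

theorem VacuumModule.eq_top_of_y_mem (S : Subalgebra ℂ (VacuumModule A))
    (hS : ∀ i m, ι ℂ (FPres.y A i m) ∈ S) : S = ⊤ := by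
  let K : LieSubalgebra ℂ (FPres A) :=
    { S.toSubmodule.comap (ι ℂ : FPres A →ₗ⁅ℂ⁆ VacuumModule A).toLinearMap with
      lie_mem' := fun {a b} (ha : ι ℂ a ∈ S) (hb : ι ℂ b ∈ S) => show ι ℂ _ ∈ S by
        rw [LieHom.map_lie, LieRing.of_associative_ring_bracket]
        exact sub_mem (mul_mem ha hb) (mul_mem hb ha) }
  have hK : K = ⊤ := FPres.eq_top_of_y_mem K hS
  have hx (x : FPres A) : ι ℂ x ∈ S := (hK ▸ LieSubalgebra.mem_top x : x ∈ K)
  let f : FPres A →ₗ⁅ℂ⁆ S :=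
    { (ι ℂ : FPres A →ₗ⁅ℂ⁆ VacuumModule A).toLinearMap.codRestrict S.toSubmodule hx with
      map_lie' := fun {a b} => Subtype.ext (LieHom.map_lie (ι ℂ) a b) }
  have hf : S.val.comp (lift ℂ f) = AlgHom.id ℂ _ := VacuumModule.algHom_ext fun i m => by
    rw [AlgHom.comp_apply, lift_ι_apply]
    rfl
  refine eq_top_iff.2 fun u _ => ?_
  have := AlgHom.congr_fun hf u
  rw [AlgHom.comp_apply, AlgHom.id_apply] at this
  rw [← this]
  exact (lift ℂ f u).2

theorem VacuumModule.end_eq_zero {T : Module.End ℂ (VacuumModule A)} (h1 : T 1 = 0)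
    (hT : ∀ i m, ⁅mulY A i m, T⁆ = 0) : T = 0 := by
  let S : Subalgebra ℂ (VacuumModule A) :=
    (Subalgebra.centralizer ℂ {T}).comap (Algebra.lmul ℂ (VacuumModule A))
  have hS (u) : u ∈ S ↔ T * Algebra.lmul ℂ _ u = Algebra.lmul ℂ _ u * T := by
    simp [S, Subalgebra.mem_centralizer_iff]
  have htop := VacuumModule.eq_top_of_y_mem S fun i m => by
    rw [hS]
    exact (sub_eq_zero.1 (hT i m)).symm
  refine LinearMap.ext fun u => ?_
  have hu := (hS u).1 (htop ▸ Algebra.mem_top)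
  simpa [h1] using LinearMap.congr_fun hu 1

/-- An operator on the vacuum module is determined by its commutators with the `y_{i,m}`, which
may be prescribed whenever this is consistent with the relations to first order. -/
theorem VacuumModule.exists_end (D : I → ℤ → Module.End ℂ (VacuumModule A))
    (hD : IsLocalSerre A fun i m =>
      (TrivSqZeroExt.inl (mulY A i m) + TrivSqZeroExt.inr (D i m) :
        DualNumber (Module.End ℂ (VacuumModule A)))) :
    ∃ T : Module.End ℂ (VacuumModule A), T 1 = 0 ∧ ∀ i m, ⁅T, mulY A i m⁆ = D i m := by
  obtain ⟨F, hF⟩ := FPres.exists_lift hD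
  let G := lift ℂ F
  have hG (i m) : G (ι ℂ (FPres.y A i m)) =
      TrivSqZeroExt.inl (mulY A i m) + TrivSqZeroExt.inr (D i m) := by
    rw [← hF]
    exact lift_ι_apply ℂ F _
  have hfst : (TrivSqZeroExt.fstHom ℂ _ _).comp G = Algebra.lmul ℂ (VacuumModule A) :=
    VacuumModule.algHom_ext fun i m => by
      rw [AlgHom.comp_apply, hG]
      simp [mulY]
  have hfst' (u) : (G u).fst = Algebra.lmul ℂ (VacuumModule A) u := AlgHom.congr_fun hfst u
  let T : Module.End ℂ (VacuumModule A) :=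
    LinearMap.applyₗ (1 : VacuumModule A) ∘ₗ
      (TrivSqZeroExt.sndHom _ _).restrictScalars ℂ ∘ₗ G.toLinearMap
  have hT (u) : T u = (G u).snd 1 := rfl
  refine ⟨T, by simp [hT], fun i m => LinearMap.ext fun u => ?_⟩
  rw [LieRing.of_associative_ring_bracket, LinearMap.sub_apply, Module.End.mul_apply,
    Module.End.mul_apply, mulY_apply, mulY_apply, hT, hT, map_mul, DualNumber.snd_mul, hfst',
    hfst', hG]
  simp

theorem VacuumModule.exists_h (hA : ∀ i, A i i = 2) (a : I → ℂ) (k : ℤ) :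
    ∃ T : Module.End ℂ (VacuumModule A), T 1 = 0 ∧
      ∀ i m, ⁅T, mulY A i m⁆ = a i • mulY A i (k + m) :=
  VacuumModule.exists_end _ <|
    isDerivAlong_fst_snd.scale_isLocalSerre eq_zero_of_fst_snd hA
      (by simpa using isLocalSerre_mulY A) (a := a) (k := k) (by simp)

theorem VacuumModule.exists_x [DecidableEq I] (hA : ∀ i, A i i = 2)
    (hA0 : ∀ i j, A i j = 0 → A j i = 0) {h : I → ℤ → Module.End ℂ (VacuumModule A)}
    (hh : ∀ i j m n, ⁅h i m, mulY A j n⁆ = (A i j : ℂ) • mulY A j (m + n)) (k : I) (l : ℤ) :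
    ∃ T : Module.End ℂ (VacuumModule A), T 1 = 0 ∧
      ∀ i m, ⁅T, mulY A i m⁆ = if i = k then h i (m + l) else 0 :=
  VacuumModule.exists_end _ <|
    isDerivAlong_fst_snd.contract_isLocalSerre eq_zero_of_fst_snd hA hA0
      (by simpa only [fst_inl_add_inr] using isLocalSerre_mulY A) (h := h) (k := k) (l := l)
      (by simpa only [fst_inl_add_inr] using hh) (fun _ _ => snd_inl_add_inr _ _)

theorem VacuumModule.exists_isLevelZero [DecidableEq I] (hA : ∀ i, A i i = 2)
    (hA0 : ∀ i j, A i j = 0 → A j i = 0) :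
    ∃ h xm : I → ℤ → Module.End ℂ (VacuumModule A), IsLevelZero A h (mulY A) xm := by
  choose h h1 hy using fun (i : I) (m : ℤ) =>
    VacuumModule.exists_h (A := A) hA (fun j => (A i j : ℂ)) m
  have hp (i j m n) : ⁅h i m, mulY A j n⁆ = (A i j : ℂ) • mulY A j (m + n) := hy i m j n
  have yh (i j m n) : ⁅mulY A j n, h i m⁆ = -((A i j : ℂ) • mulY A j (m + n)) := by
    rw [← lie_skew, hp]
  choose x x1 xy using VacuumModule.exists_x hA hA0 hp
  have pm (i j m n) : ⁅mulY A i m, -x j n⁆ = if i = j then h j (m + n) else 0 := by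
    rw [lie_neg, lie_skew, xy]
    by_cases hij : i = j
    · subst hij; simp
    · simp [hij]
  have hh (i j m n) : ⁅h i m, h j n⁆ = 0 := by
    refine VacuumModule.end_eq_zero ?_ fun k l => ?_
    · simp [LieRing.of_associative_ring_bracket, h1]
    · rw [leibniz_lie, yh, yh, neg_lie, lie_neg, smul_lie, lie_smul, yh, hp, smul_neg,
        smul_comm, show n + (m + l) = m + (n + l) by ring]
      abel
  have hm (i j m n) : ⁅h i m, -x j n⁆ = -((A i j : ℂ) • -x j (m + n)) := by
    refine eq_neg_of_add_eq_zero_left (VacuumModule.end_eq_zero ?_ fun k l => ?_)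
    · simp [LieRing.of_associative_ring_bracket, h1, x1]
    · rw [lie_add, leibniz_lie, yh, neg_lie, smul_lie, pm, pm, lie_smul, pm]
      split_ifs with hkj
      · subst hkj
        rw [hh, show m + l + n = l + (m + n) by ring]
        simp
      · simp
  have pm' (k l i m) : ⁅-mulY A k l, -x i m⁆ = if i = k then -h i (m + l) else 0 := by
    rw [neg_lie, pm]
    by_cases hik : i = k
    · simp [hik, add_comm]
    · simp [hik, Ne.symm hik]
  have hm' (i j m n) : ⁅-h i m, -x j n⁆ = (A i j : ℂ) • -x j (m + n) := by
    rw [neg_lie, hm, neg_neg]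
  have ext0 {T : Module.End ℂ (VacuumModule A)} (hT1 : T 1 = 0)
      (hT : ∀ k l, ⁅-mulY A k l, T⁆ = 0) : T = 0 :=
    VacuumModule.end_eq_zero hT1 fun k l => by simpa only [neg_lie, neg_eq_zero] using hT k l
  have xloc : IsLocal A fun i m => -x i m := by
    refine ⟨fun i j m n hij => sub_eq_zero.1 (ext0 ?_ fun k l => ?_),
      fun i j m n hij => ext0 ?_ fun k l => ?_⟩
    · simp [LieRing.of_associative_ring_bracket, x1]
    · rw [lie_sub, sub_eq_zero]
      exact (IsDerivAlong.ad (-mulY A k l)).contract_loc (y := fun i m => -x i m)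
        (h := fun i m => -h i m) hm' (pm' k l) i j m n
    · simp [LieRing.of_associative_ring_bracket, x1]
    · exact (IsDerivAlong.ad (-mulY A k l)).contract_comm (y := fun i m => -x i m)
        (h := fun i m => -h i m) hm' (pm' k l) m n hij (hA0 i j hij)
  have adPow1 (i j r s) : adPow (fun i m => -x i m) i j r s 1 = 0 := by
    induction r with
    | zero => simp [adPow, x1]
    | succ r ih => simp [adPow, LieRing.of_associative_ring_bracket, x1, ih]
  refine ⟨h, fun i m => -x i m, hh, hp, hm, pm, isLocalSerre_mulY A,
    (xloc.isLocalSerre_iff hA).2 fun i j hij s => ext0 (adPow1 i j _ s) fun k l => ?_⟩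
  exact (IsDerivAlong.ad (-mulY A k l)).contract_serre (y := fun i m => -x i m)
    (h := fun i m => -h i m) hA xloc hm' (pm' k l) hij s

end Vacuum

/-! ### Homomorphisms out of `D` -/

namespace DAlg

variable {I L : Type} [DecidableEq I] [LieRing L] [LieAlgebra ℂ L] {A : I → I → ℤ}

theorem isLocalSerre_xp (ε : I → ℚ) : IsLocalSerre A (DAlg.xp A ε) := by
  have hz {z} (hz : z ∈ locSerreRels A ε) : (locSerreIdeal A ε).quotHom z = 0 :=
    (LieSubmodule.Quotient.mk_eq_zero _).2 (LieSubmodule.subset_lieSpan hz)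
  refine ⟨⟨fun i j m n h => sub_eq_zero.1 ?_, fun i j m n h => ?_⟩, fun i j h m n => ?_⟩
  · have := hz (Or.inl (Or.inl ⟨i, j, m, n, h, Or.inl rfl⟩))
    rwa [map_sub, LieHom.map_lie, LieHom.map_lie] at this
  · have := hz (Or.inl (Or.inr ⟨i, j, m, n, h, Or.inl rfl⟩))
    rwa [LieHom.map_lie] at this
  · have := hz (Or.inr ⟨i, j, h, m, n, Or.inl rfl⟩)
    rwa [map_iterBracket, List.map_ofFn] at this

theorem isLocalSerre_xm (ε : I → ℚ) : IsLocalSerre A (DAlg.xm A ε) := by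
  have hz {z} (hz : z ∈ locSerreRels A ε) : (locSerreIdeal A ε).quotHom z = 0 :=
    (LieSubmodule.Quotient.mk_eq_zero _).2 (LieSubmodule.subset_lieSpan hz)
  refine ⟨⟨fun i j m n h => sub_eq_zero.1 ?_, fun i j m n h => ?_⟩, fun i j h m n => ?_⟩
  · have := hz (Or.inl (Or.inl ⟨i, j, m, n, h, Or.inr rfl⟩))
    rwa [map_sub, LieHom.map_lie, LieHom.map_lie] at this
  · have := hz (Or.inl (Or.inr ⟨i, j, m, n, h, Or.inr rfl⟩))
    rwa [LieHom.map_lie] at this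
  · have := hz (Or.inr ⟨i, j, h, m, n, Or.inr rfl⟩)
    rwa [map_iterBracket, List.map_ofFn] at this

theorem exists_lift (ε : I → ℚ) {h xp xm : I → ℤ → L} (H : IsLevelZero A h xp xm) :
    ∃ F : DAlg A ε →ₗ⁅ℂ⁆ L, (∀ i m, F (DAlg.xp A ε i m) = xp i m) ∧
      ∀ i m, F (DAlg.xm A ε i m) = xm i m := by
  let f : DFree I →ₗ⁅ℂ⁆ L := FreeLieAlgebra.lift ℂ fun
    | .h i m => h i m
    | .xp i m => xp i m
    | .xm i m => xm i m
    | .c => 0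
  have fh (i m) : f (DFree.H i m) = h i m := FreeLieAlgebra.lift_of_apply ..
  have fp (i m) : f (DFree.Xp i m) = xp i m := FreeLieAlgebra.lift_of_apply ..
  have fm (i m) : f (DFree.Xm i m) = xm i m := FreeLieAlgebra.lift_of_apply ..
  have fc : f (DFree.C I) = 0 := FreeLieAlgebra.lift_of_apply ..
  obtain ⟨g, hg⟩ := LieIdeal.exists_quotient_lift f (J := tildeIdeal A ε) rfl (by
    rintro z ((((((⟨p, rfl⟩ | ⟨p, rfl⟩) | ⟨p, rfl⟩) | ⟨p, rfl⟩) | ⟨p, rfl⟩) | ⟨p, rfl⟩) | ⟨p, rfl⟩)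
    · simp [fc]
    · simp [fc]
    · simp [fc]
    · simp only [map_sub, LieHom.map_lie, map_smul, fh, fc, H.hh, smul_zero, sub_zero]
    · simp only [map_sub, LieHom.map_lie, map_smul, fh, fp, H.hp, sub_self]
    · simp only [map_add, LieHom.map_lie, map_smul, fh, fm, H.hm, neg_add_cancel]
    · simp only [map_sub, LieHom.map_lie, fp, fm, H.pm]
      split_ifs <;> simp [fh, fc])
  have gp (i m) : g (DTilde.xp A ε i m) = xp i m := (hg _).trans (fp i m)
  have gm (i m) : g (DTilde.xm A ε i m) = xm i m := (hg _).trans (fm i m)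
  have Hp := H.isLocalSerre_p
  have Hm := H.isLocalSerre_m
  obtain ⟨F, hF⟩ := LieIdeal.exists_quotient_lift g (J := locSerreIdeal A ε) rfl (by
    rintro z ((⟨i, j, m, n, h, rfl | rfl⟩ | ⟨i, j, m, n, h, rfl | rfl⟩) |
      ⟨i, j, h, m, n, rfl | rfl⟩)
    · simp only [map_sub, LieHom.map_lie, gp, Hp.loc i j m n h, sub_self]
    · simp only [map_sub, LieHom.map_lie, gm, Hm.loc i j m n h, sub_self]
    · simp only [LieHom.map_lie, gp, Hp.comm i j m n h]
    · simp only [LieHom.map_lie, gm, Hm.comm i j m n h]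
    · rw [map_iterBracket, List.map_ofFn, gp]
      simpa only [Function.comp_def, gp] using Hp.serre i j h m n
    · rw [map_iterBracket, List.map_ofFn, gm]
      simpa only [Function.comp_def, gm] using Hm.serre i j h m n)
  exact ⟨F, fun i m => (hF _).trans (gp i m), fun i m => (hF _).trans (gm i m)⟩

end DAlg

section Embedding

attribute [local instance] LieRing.ofAssociativeRing

variable {I L : Type} [LieRing L] [LieAlgebra ℂ L] {A : I → I → ℤ}

/-- A family acting on the vacuum module by left multiplications generates a copy of `F⁺`. -/
theorem FPres.exists_injective_lift {x : I → ℤ → L} (hx : IsLocalSerre A x)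
    (F : L →ₗ⁅ℂ⁆ Module.End ℂ (VacuumModule A)) (hF : ∀ i m, F (x i m) = mulY A i m) :
    ∃ φ : FPres A →ₗ⁅ℂ⁆ L, (∀ i m, φ (FPres.y A i m) = x i m) ∧
      (∀ ψ : FPres A →ₗ⁅ℂ⁆ L, (∀ i m, ψ (FPres.y A i m) = x i m) → ψ = φ) ∧
      Function.Injective φ ∧
      φ.range = LieSubalgebra.lieSpan ℂ L (Set.range fun p : I × ℤ => x p.1 p.2) := by
  obtain ⟨φ, hφ⟩ := FPres.exists_lift hx
  refine ⟨φ, hφ, fun ψ hψ => FPres.hom_ext fun i m => (hψ i m).trans (hφ i m).symm, ?_,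
    FPres.range_eq φ hφ⟩
  have hcomp : F.comp φ = (Algebra.lmul ℂ (VacuumModule A)).toLieHom.comp
      (UniversalEnvelopingAlgebra.ι ℂ) :=
    FPres.hom_ext fun i m => by
      rw [LieHom.comp_apply, hφ, hF]
      rfl
  have hinj (z) : F (φ z) 1 = UniversalEnvelopingAlgebra.ι ℂ z :=
    (LinearMap.congr_fun (LieHom.congr_fun hcomp z) 1).trans (mul_one _)
  intro a b hab
  exact FPres.injective_ι A (by rw [← hinj, hab, hinj])

/-- `D` acts on the vacuum module with `x⁺`, or alternatively `x⁻`, acting by multiplication. -/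
theorem DAlg.exists_hom_end [DecidableEq I] (hA : ∀ i, A i i = 2)
    (hA0 : ∀ i j, A i j = 0 → A j i = 0) (ε : I → ℚ) :
    ∃ F G : DAlg A ε →ₗ⁅ℂ⁆ Module.End ℂ (VacuumModule A),
      (∀ i m, F (DAlg.xp A ε i m) = mulY A i m) ∧ ∀ i m, G (DAlg.xm A ε i m) = mulY A i m := by
  obtain ⟨h, xm, H⟩ := VacuumModule.exists_isLevelZero hA hA0
  obtain ⟨F, hF, -⟩ := DAlg.exists_lift ε H
  obtain ⟨G, -, hG⟩ := DAlg.exists_lift ε H.swap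
  exact ⟨F, G, hF, hG⟩

end Embedding

section Stmt13

variable {I : Type} [Fintype I] [DecidableEq I] (A : I → I → ℤ) (ε : I → ℚ)

/-- for `A` of finite or affine type, not of type `A₁⁽¹⁾`, the unique Lie
algebra homomorphism `F⁺ → D` with `y_{i,m} ↦ x⁺_{i,m}` is injective, with image the Lie
subalgebra of `D` generated by the `x⁺_{i,m}`; and analogously for the `x⁻_{i,m}`. -/
theorem stmt13 (hGCM : IsGCM A) (hFA : IsFinOrAffType A)
    (hnotA11 : ¬(Fintype.card I = 2 ∧ ∀ i j, i ≠ j → A i j = -2))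
    (hε : ∀ i, 0 < ε i)
    (hsym : ∀ i j, (ε i : ℚ) * (A i j : ℚ) = (ε j : ℚ) * (A j i : ℚ)) :
    (∃ φ : FPres A →ₗ⁅ℂ⁆ DAlg A ε,
      (∀ (i : I) (m : ℤ), φ (FPres.y A i m) = DAlg.xp A ε i m) ∧
      (∀ ψ : FPres A →ₗ⁅ℂ⁆ DAlg A ε,
        (∀ (i : I) (m : ℤ), ψ (FPres.y A i m) = DAlg.xp A ε i m) → ψ = φ) ∧
      Function.Injective φ ∧
      φ.range = LieSubalgebra.lieSpan ℂ (DAlg A ε)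
        (Set.range fun p : I × ℤ => DAlg.xp A ε p.1 p.2)) ∧
    (∃ φ : FPres A →ₗ⁅ℂ⁆ DAlg A ε,
      (∀ (i : I) (m : ℤ), φ (FPres.y A i m) = DAlg.xm A ε i m) ∧
      (∀ ψ : FPres A →ₗ⁅ℂ⁆ DAlg A ε,
        (∀ (i : I) (m : ℤ), ψ (FPres.y A i m) = DAlg.xm A ε i m) → ψ = φ) ∧
      Function.Injective φ ∧
      φ.range = LieSubalgebra.lieSpan ℂ (DAlg A ε)
        (Set.range fun p : I × ℤ => DAlg.xm A ε p.1 p.2)) := by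
  obtain ⟨hA, -, hA0⟩ := hGCM
  obtain ⟨F, G, hF, hG⟩ := DAlg.exists_hom_end hA (fun i j => (hA0 i j).1) ε
  exact ⟨FPres.exists_injective_lift (DAlg.isLocalSerre_xp ε) F hF,
    FPres.exists_injective_lift (DAlg.isLocalSerre_xm ε) G hG⟩

end Stmt13
end
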